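/- arXiv:1604.07909 — 8 statements merged into one kernel-verified Lean document; each statement's English description precedes it below -/
import Mathlib

section
/- For each real number ξ, the function g(t) = Σ_{k=0}^n e^{ξ·ν_k(t)} of the real variable t, where ν_0(t), ν_1(t), …, ν_n(t) are the n+1 roots (all real and simple) of the equation P(z) − t·Q(z) = 0, is exponentially convex on (−∞, ∞). -/
open Polynomial ComplexOrder

/-- A function `f` is exponentially convex on the set `S` if it is continuous on `S` and
for every `N`, reals `t 1, …, t N` with all pairwise sums in `S`, and complex `ζ 1, …, ζ N`,
the quadratic form `∑ f (t r + t s) ζ r conj (ζ s)` is real and nonnegative. -/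
def ExpConvexOn (f : ℝ → ℝ) (S : Set ℝ) : Prop :=
  ContinuousOn f S ∧
  ∀ (N : ℕ) (t : Fin N → ℝ), (∀ r s, t r + t s ∈ S) →
    ∀ ζ : Fin N → ℂ,
      (0 : ℂ) ≤ ∑ r, ∑ s, (f (t r + t s) : ℂ) * ζ r * (starRingEnd ℂ) (ζ s)

open Filter Topology Matrix

section Diagonalization

variable {ι : Type*} [Fintype ι] [DecidableEq ι] {M : Matrix ι ι ℝ} {v : ι → ι → ℝ} {lam : ι → ℝ}

/-- A real matrix with a full family of eigenvectors for distinct eigenvalues is diagonalizable. -/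
lemma exists_eq_conj_diagonal (hlam : Function.Injective lam) (hv : ∀ i, v i ≠ 0)
    (hM : ∀ i, M *ᵥ v i = lam i • v i) :
    ∃ V : Matrix ι ι ℝ, IsUnit V ∧ M = V * diagonal lam * V⁻¹ := by
  have hli : LinearIndependent ℝ v :=
    Module.End.eigenvectors_linearIndependent' (Matrix.toLin' M) lam hlam v fun i =>
      Module.End.hasEigenvector_iff.2
        ⟨Module.End.mem_eigenspace_iff.2 (by simpa using hM i), hv i⟩
  have hU : IsUnit (Matrix.of v)ᵀ := linearIndependent_cols_iff_isUnit.1 hli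
  refine ⟨(Matrix.of v)ᵀ, hU, ?_⟩
  have hMV : M * (Matrix.of v)ᵀ = (Matrix.of v)ᵀ * diagonal lam := by
    ext i j
    have h := congrFun (hM j) i
    rw [mul_diagonal]
    simpa [mul_apply, mulVec, dotProduct, mul_comm] using h
  rw [← hMV, mul_nonsing_inv_cancel_right _ _ ((isUnit_iff_isUnit_det _).1 hU)]

lemma trace_pow_eq_sum (hlam : Function.Injective lam) (hv : ∀ i, v i ≠ 0)
    (hM : ∀ i, M *ᵥ v i = lam i • v i) (m : ℕ) :
    (M ^ m).trace = ∑ i, lam i ^ m := by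
  obtain ⟨V, hV, rfl⟩ := exists_eq_conj_diagonal hlam hv hM
  have hdet := (isUnit_iff_isUnit_det _).1 hV
  have hpow : (V * diagonal lam * V⁻¹) ^ m = V * diagonal lam ^ m * V⁻¹ := by
    obtain ⟨u, rfl⟩ := hV
    rw [← coe_units_inv, Units.conj_pow]
  rw [hpow, trace_mul_comm, ← mul_assoc, nonsing_inv_mul _ hdet, one_mul, diagonal_pow,
    trace_diagonal]
  rfl

lemma trace_exp_eq_sum (hlam : Function.Injective lam) (hv : ∀ i, v i ≠ 0)
    (hM : ∀ i, M *ᵥ v i = lam i • v i) :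
    (NormedSpace.exp M).trace = ∑ i, Real.exp (lam i) := by
  obtain ⟨V, hV, rfl⟩ := exists_eq_conj_diagonal hlam hv hM
  have hdet := (isUnit_iff_isUnit_det _).1 hV
  rw [Matrix.exp_conj _ _ hV, trace_mul_comm, ← mul_assoc, nonsing_inv_mul _ hdet, one_mul,
    Matrix.exp_diagonal, trace_diagonal]
  simp [Pi.coe_exp, Real.exp_eq_exp_ℝ]

end Diagonalization

lemma continuous_trace_exp {ι : Type*} [Fintype ι] [DecidableEq ι] {M : ℝ → Matrix ι ι ℝ}
    (hM : Continuous M) : Continuous fun t => (NormedSpace.exp (M t)).trace := by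
  let _ : NormedRing (Matrix ι ι ℝ) := Matrix.linftyOpNormedRing
  let _ : NormedAlgebra ℝ (Matrix ι ι ℝ) := Matrix.linftyOpNormedAlgebra
  let _ : NormedAlgebra ℚ (Matrix ι ι ℝ) := NormedAlgebra.restrictScalars ℚ ℝ _
  have h : Continuous (NormedSpace.exp : Matrix ι ι ℝ → Matrix ι ι ℝ) := NormedSpace.exp_continuous
  exact (h.comp hM).matrix_trace

section PosSemidef

variable {ι : Type*} [Fintype ι]

lemma posSemidef_rankOne (p : ι → ℝ) :
    (Matrix.of fun r s => p r * p s).PosSemidef := by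
  simpa [vecMulVec, Pi.star_def] using! posSemidef_vecMulVec_self_star p

lemma posSemidef_const {c : ℝ} (hc : 0 ≤ c) :
    (Matrix.of fun _ _ : ι => c).PosSemidef := by
  simpa [Real.mul_self_sqrt hc] using posSemidef_rankOne fun _ : ι => √c

lemma posSemidef_of_tendsto {K : ℕ → Matrix ι ι ℝ} {L : Matrix ι ι ℝ}
    (hK : ∀ᶠ m in atTop, (K m).PosSemidef)
    (hL : ∀ r s, Tendsto (fun m => K m r s) atTop (𝓝 (L r s))) : L.PosSemidef := by
  refine .of_dotProduct_mulVec_nonneg ?_ fun x => ?_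
  · ext r s
    refine tendsto_nhds_unique ((hL s r).congr' ?_) (hL r s)
    filter_upwards [hK] with m hm
    simpa using hm.1.apply r s
  · refine ge_of_tendsto (f := fun m => star x ⬝ᵥ (K m *ᵥ x)) ?_
      (hK.mono fun m hm => hm.dotProduct_mulVec_nonneg x)
    simp only [dotProduct, mulVec]
    exact tendsto_finsetSum _ fun r _ => .mul tendsto_const_nhds <|
      tendsto_finsetSum _ fun s _ => (hL r s).mul tendsto_const_nhds

/-- The kernel `1 / (c - (a r + a s))` is positive semidefinite: it equals
`c / ((c - a r) * (c - a s))` times a geometric series in `a r * a s / ((c - a r) * (c - a s))`. -/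
lemma posSemidef_inv_sub_add {c : ℝ} {a : ι → ℝ} (hc : 0 < c) (ha : ∀ r, 2 * a r < c) :
    (Matrix.of fun r s => (c - (a r + a s))⁻¹).PosSemidef := by
  have hca (r) : 0 < c - a r := by linarith [ha r]
  set p : ι → ℝ := fun r => a r / (c - a r) with hp
  have hp1 (r) : |p r| < 1 := by
    rw [hp, abs_div, abs_of_pos (hca r), div_lt_one (hca r), abs_lt]
    constructor <;> linarith [ha r]
  have hgeom : (Matrix.of fun r s => (1 - p r * p s)⁻¹).PosSemidef := by
    refine posSemidef_of_tendsto
      (K := fun m => ∑ k ∈ Finset.range m, Matrix.of fun r s => p r ^ k * p s ^ k)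
      (.of_forall fun m => posSemidef_sum _ fun k _ => posSemidef_rankOne fun r => p r ^ k)
      fun r s => ?_
    have h := (hasSum_geometric_of_abs_lt_one (r := p r * p s) (by
      rw [abs_mul]
      exact mul_lt_one_of_nonneg_of_lt_one_left (abs_nonneg _) (hp1 r) (hp1 s).le)).tendsto_sum_nat
    simpa [Matrix.sum_apply, mul_pow] using h
  suffices h : (Matrix.of fun r s => (c - (a r + a s))⁻¹) =
      ((Matrix.of fun _ _ => c) ⊙ Matrix.of fun r s => (c - a r)⁻¹ * (c - a s)⁻¹) ⊙
        Matrix.of fun r s => (1 - p r * p s)⁻¹ by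
    rw [h]
    exact ((posSemidef_const hc.le).hadamard (posSemidef_rankOne _)).hadamard hgeom
  ext r s
  have h1 := (hca r).ne'
  have h2 := (hca s).ne'
  have h3 : c - (a r + a s) ≠ 0 := by linarith [ha r, ha s]
  have h4 : 1 - p r * p s = c * (c - (a r + a s)) / ((c - a r) * (c - a s)) := by
    simp only [hp]
    field_simp
    ring
  simp only [of_apply, hadamard_apply]
  rw [h4]
  field_simp

/-- Powers of a matrix-valued function preserve entrywise positive definiteness of kernels. -/
lemma posSemidef_pow_apply {κ T : Type*} [Fintype κ] [DecidableEq κ] {G : T → Matrix κ κ ℝ}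
    {τ : ι → ι → T}
    (hG : ∀ i j, (Matrix.of fun r s => G (τ r s) i j).PosSemidef) (m : ℕ) (i j : κ) :
    (Matrix.of fun r s => (G (τ r s) ^ m) i j).PosSemidef := by
  induction m generalizing j with
  | zero =>
    simp only [pow_zero]
    exact posSemidef_const (by rw [one_apply]; positivity)
  | succ m ih =>
    have h : (Matrix.of fun r s => (G (τ r s) ^ (m + 1)) i j) =
        ∑ l, (Matrix.of fun r s => (G (τ r s) ^ m) i l) ⊙ Matrix.of fun r s => G (τ r s) l j := by
      ext r s
      simp [pow_succ, mul_apply, Matrix.sum_apply]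
    rw [h]
    exact posSemidef_sum Finset.univ fun l _ => (ih l).hadamard (hG l j)

lemma complex_form_nonneg {K : Matrix ι ι ℝ} (hK : K.PosSemidef) (ζ : ι → ℂ) :
    (0 : ℂ) ≤ ∑ r, ∑ s, (K r s : ℂ) * ζ r * (starRingEnd ℂ) (ζ s) := by
  have hsymm (r s) : K r s = K s r := by simpa using (hK.1.apply r s).symm
  have key (x : ι → ℝ) : 0 ≤ ∑ r, ∑ s, K r s * x r * x s := by
    have h := hK.dotProduct_mulVec_nonneg x
    simp only [dotProduct, mulVec, Finset.mul_sum] at h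
    refine h.trans_eq (Finset.sum_congr rfl fun r _ => Finset.sum_congr rfl fun s _ => ?_)
    rw [Pi.star_apply, star_trivial]
    ring
  rw [Complex.nonneg_iff]
  constructor
  · have h := add_nonneg (key fun r => (ζ r).re) (key fun r => (ζ r).im)
    simp only [← Finset.sum_add_distrib] at h
    simpa [Complex.re_sum, mul_assoc, mul_add] using h
  · have h : ∑ r, ∑ s, K r s * ((ζ r).re * (ζ s).im) = ∑ r, ∑ s, K r s * ((ζ r).im * (ζ s).re) := by
      rw [Finset.sum_comm]
      refine Finset.sum_congr rfl fun r _ => Finset.sum_congr rfl fun s _ => ?_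
      rw [hsymm s r]
      ring
    simp [Complex.im_sum, mul_assoc, mul_add, Finset.sum_add_distrib, h]

end PosSemidef

section Arrow

variable {n : ℕ}

/-- The arrow matrix with diagonal `t, μ 0, …, μ (n - 1)`, first row `1` and first column `α`;
its characteristic polynomial is `P - t Q`. -/
def arrowMatrix (μ α : Fin n → ℝ) (t : ℝ) : Matrix (Fin (n + 1)) (Fin (n + 1)) ℝ :=
  Matrix.of (Fin.cons (Fin.cons t fun _ => 1) fun j => Fin.cons (α j) fun l => diagonal μ j l)

/-- The eigenvector of the arrow matrix for the eigenvalue `x`. -/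
noncomputable def arrowVec (μ α : Fin n → ℝ) (x : ℝ) : Fin (n + 1) → ℝ :=
  Fin.cons 1 fun j => α j / (x - μ j)

/-- The Schur complement of `1 - σ • arrowMatrix μ α t` with respect to its lower diagonal block. -/
noncomputable def schur (μ α : Fin n → ℝ) (σ t : ℝ) : ℝ :=
  1 - ∑ j, σ ^ 2 * α j * (1 - σ * μ j)⁻¹ - σ * t

/-- The inverse of `1 - σ • arrowMatrix μ α t`, conjugated by a diagonal matrix so that its entries
are nonnegative for small `σ` of either sign. -/
noncomputable def arrowResolvent (μ α : Fin n → ℝ) (σ t : ℝ) :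
    Matrix (Fin (n + 1)) (Fin (n + 1)) ℝ :=
  diagonal (Fin.cons 0 fun j => (1 - σ * μ j)⁻¹) +
    (schur μ α σ t)⁻¹ • vecMulVec (Fin.cons 1 fun j => σ ^ 2 * α j * (1 - σ * μ j)⁻¹)
      (Fin.cons 1 fun j => (1 - σ * μ j)⁻¹)

lemma arrowVec_ne_zero (μ α : Fin n → ℝ) (x : ℝ) : arrowVec μ α x ≠ 0 := fun h => by
  simpa [arrowVec] using congrFun h 0

lemma continuous_arrowMatrix (μ α : Fin n → ℝ) : Continuous (arrowMatrix μ α) := by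
  refine continuous_matrix fun i j => ?_
  refine Fin.cases ?_ (fun i => ?_) i <;> refine Fin.cases ?_ (fun j => ?_) j <;>
    simp [arrowMatrix] <;> fun_prop

/-- The equation `R(x) = t`. -/
def IsSecularRoot (μ α : Fin n → ℝ) (t x : ℝ) : Prop :=
  (∀ j, x ≠ μ j) ∧ t + ∑ j, α j / (x - μ j) = x

variable {μ α : Fin n → ℝ} {t x σ : ℝ}

lemma isSecularRoot_of_eval_eq_zero (hμ : Function.Injective μ) (hα : ∀ j, α j ≠ 0)
    (h : (X * ∏ k, (X - C (μ k)) - ∑ k, C (α k) * ∏ j ∈ Finset.univ.erase k, (X - C (μ j))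
      - C t * ∏ k, (X - C (μ k))).eval x = 0) : IsSecularRoot μ α t x := by
  simp only [eval_sub, eval_mul, eval_X, eval_C, eval_prod, eval_finsetSum] at h
  have hne (i) : x ≠ μ i := by
    rintro rfl
    rw [Finset.prod_eq_zero (Finset.mem_univ i) (sub_self _), Finset.sum_eq_single i] at h
    · have : ∏ j ∈ Finset.univ.erase i, (μ i - μ j) ≠ 0 :=
        Finset.prod_ne_zero_iff.2 fun j hj =>
          sub_ne_zero.2 fun hij => Finset.ne_of_mem_erase hj (hμ hij.symm)
      simp [hα i, this] at h
    · intro k _ hk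
      rw [Finset.prod_eq_zero (Finset.mem_erase.2 ⟨hk.symm, Finset.mem_univ i⟩) (sub_self _),
        mul_zero]
    · simp
  refine ⟨hne, ?_⟩
  have hQ : ∏ k, (x - μ k) ≠ 0 := Finset.prod_ne_zero_iff.2 fun j _ => sub_ne_zero.2 (hne j)
  have hsum : ∑ k, α k * ∏ j ∈ Finset.univ.erase k, (x - μ j)
      = (∑ k, α k / (x - μ k)) * ∏ k, (x - μ k) := by
    rw [Finset.sum_mul]
    refine Finset.sum_congr rfl fun k _ => ?_
    rw [← Finset.mul_prod_erase _ _ (Finset.mem_univ k)]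
    field_simp [sub_ne_zero.2 (hne k)]
  rw [hsum, ← sub_mul, ← sub_mul] at h
  linarith [(mul_eq_zero.1 h).resolve_right hQ]

lemma arrowMatrix_mulVec (h : IsSecularRoot μ α t x) :
    arrowMatrix μ α t *ᵥ arrowVec μ α x = x • arrowVec μ α x := by
  ext i
  refine Fin.cases ?_ (fun i => ?_) i
  · simpa [mulVec, dotProduct, Fin.sum_univ_succ, arrowMatrix, arrowVec] using h.2
  · have := sub_ne_zero.2 (h.1 i)
    simp [mulVec, dotProduct, Fin.sum_univ_succ, arrowMatrix, arrowVec, diagonal_apply]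
    field_simp
    ring

lemma one_sub_mul_mul_eq_schur (h : IsSecularRoot μ α t x) (hσ : ∀ j, 1 - σ * μ j ≠ 0) :
    (1 - σ * x) * (1 + ∑ j, (1 - σ * μ j)⁻¹ * (σ * α j / (x - μ j))) = schur μ α σ t := by
  have hj (j) : (1 - σ * x) * ((1 - σ * μ j)⁻¹ * (σ * α j / (x - μ j)))
      = σ * (α j / (x - μ j)) - σ ^ 2 * α j * (1 - σ * μ j)⁻¹ := by
    have h1 := hσ j
    have h2 := sub_ne_zero.2 (h.1 j)
    field_simp
    ring
  rw [mul_add, Finset.mul_sum, Finset.sum_congr rfl fun j _ => hj j, Finset.sum_sub_distrib,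
    ← Finset.mul_sum, schur]
  linear_combination σ * h.2

lemma arrowResolvent_mulVec (h : IsSecularRoot μ α t x) (hσ : ∀ j, 1 - σ * μ j ≠ 0)
    (hρ : schur μ α σ t ≠ 0) :
    arrowResolvent μ α σ t *ᵥ arrowVec μ (fun j => σ * α j) x
      = (1 - σ * x)⁻¹ • arrowVec μ (fun j => σ * α j) x := by
  have key := one_sub_mul_mul_eq_schur h hσ
  have hx : 1 - σ * x ≠ 0 := fun h0 => hρ (by rw [← key, h0, zero_mul])
  have hw : (schur μ α σ t)⁻¹ * (1 + ∑ j, (1 - σ * μ j)⁻¹ * (σ * α j / (x - μ j)))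
      = (1 - σ * x)⁻¹ := by
    rw [← key] at hρ ⊢
    rw [mul_inv, mul_assoc, inv_mul_cancel₀ (right_ne_zero_of_mul hρ), mul_one]
  have hdot : (Fin.cons 1 fun j => (1 - σ * μ j)⁻¹ : Fin (n + 1) → ℝ)
      ⬝ᵥ arrowVec μ (fun j => σ * α j) x
      = 1 + ∑ j, (1 - σ * μ j)⁻¹ * (σ * α j / (x - μ j)) := by
    simp [dotProduct, Fin.sum_univ_succ, arrowVec]
  rw [arrowResolvent, add_mulVec, smul_mulVec, vecMulVec_mulVec, hdot]
  ext i
  simp only [Pi.add_apply, mulVec_diagonal, Pi.smul_apply, smul_eq_mul,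
    MulOpposite.smul_eq_mul_unop, MulOpposite.unop_op]
  refine Fin.cases ?_ (fun i => ?_) i
  · simpa [arrowVec] using hw
  · simp only [Fin.cons_succ, arrowVec]
    rw [mul_left_comm, hw]
    have h1 := hσ i
    have h2 := sub_ne_zero.2 (h.1 i)
    field_simp
    ring

lemma posSemidef_arrowResolvent_pow_trace {ι : Type*} [Fintype ι] (hα : ∀ j, 0 < α j)
    (hσ : ∀ j, 0 < 1 - σ * μ j) (hc : 0 < schur μ α σ 0) {t : ι → ℝ}
    (ht : ∀ r, 0 < schur μ α σ (2 * t r)) (m : ℕ) :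
    (Matrix.of fun r s => (arrowResolvent μ α σ (t r + t s) ^ m).trace).PosSemidef := by
  have hρ : (Matrix.of fun r s => (schur μ α σ (t r + t s))⁻¹).PosSemidef := by
    convert posSemidef_inv_sub_add (a := fun r => σ * t r) hc (fun r => ?_) using 4
    · simp [schur]
      ring
    · have := ht r
      simp only [schur] at this ⊢
      linarith
  have hentry (i j) :
      (Matrix.of fun r s => arrowResolvent μ α σ (t r + t s) i j).PosSemidef := by
    have hd : 0 ≤ (diagonal (Fin.cons 0 fun j => (1 - σ * μ j)⁻¹) :
        Matrix (Fin (n + 1)) (Fin (n + 1)) ℝ) i j := by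
      rw [diagonal_apply]
      split_ifs
      · exact Fin.cases (by simp) (fun i => by simpa using (hσ i).le) i
      · rfl
    have hu : 0 ≤ vecMulVec (Fin.cons 1 fun j => σ ^ 2 * α j * (1 - σ * μ j)⁻¹)
        (Fin.cons 1 fun j => (1 - σ * μ j)⁻¹ : Fin (n + 1) → ℝ) i j := by
      refine mul_nonneg (Fin.cases (by simp) (fun i => ?_) i) (Fin.cases (by simp) (fun j => ?_) j)
      · have := hα i
        have := hσ i
        simp only [Fin.cons_succ]
        positivity
      · simpa using (hσ j).le
    exact (posSemidef_const hd).add (hρ.hadamard (posSemidef_const hu))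
  convert posSemidef_sum Finset.univ fun i _ =>
    posSemidef_pow_apply (τ := fun r s => t r + t s) hentry m i i using 1
  ext r s
  simp [Matrix.trace, Matrix.sum_apply]

lemma eventually_one_sub_mul_pos {s : ℕ → ℝ} (hs : Tendsto s atTop (𝓝 0)) (t : ℝ) :
    ∀ᶠ m in atTop, 0 < 1 - s m * t := by
  have h : Tendsto (fun m => 1 - s m * t) atTop (𝓝 1) := by
    simpa using (hs.mul_const t).const_sub 1
  exact h.eventually_const_lt zero_lt_one

lemma eventually_schur_pos (μ α : Fin n → ℝ) {s : ℕ → ℝ} (hs : Tendsto s atTop (𝓝 0)) (t : ℝ) :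
    ∀ᶠ m in atTop, 0 < schur μ α (s m) t := by
  have hcont : ContinuousAt (fun σ => schur μ α σ t) 0 := by
    unfold schur
    fun_prop (disch := simp)
  have h := hcont.tendsto.comp hs
  have h1 : schur μ α 0 t = 1 := by simp [schur]
  rw [h1] at h
  exact h.eventually_const_lt zero_lt_one

end Arrow

lemma tendsto_inv_one_sub_div_pow (y : ℝ) :
    Tendsto (fun m : ℕ => ((1 - y / m)⁻¹) ^ m) atTop (𝓝 (Real.exp y)) := by
  have h := (Real.tendsto_one_add_div_pow_exp (-y)).inv₀ (Real.exp_ne_zero _)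
  rw [Real.exp_neg, inv_inv] at h
  simpa [inv_pow, neg_div, ← sub_eq_add_neg] using h

theorem stmt_0 (n : ℕ) (hn : 1 ≤ n) (μ α : Fin n → ℝ)
    (hμ : ∀ i j : Fin n, i < j → μ j < μ i) (hα : ∀ k, 0 < α k)
    (Q P : Polynomial ℝ)
    (hQ : Q = ∏ k, (X - C (μ k)))
    (hP : P = X * Q - ∑ k, C (α k) * ∏ j ∈ Finset.univ.erase k, (X - C (μ j)))
    (ν : ℝ → Fin (n + 1) → ℝ)
    (hνroot : ∀ t k, (P - C t * Q).eval (ν t k) = 0)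
    (hνanti : ∀ t, StrictAnti (ν t))
    (ξ : ℝ) :
    ExpConvexOn (fun t => ∑ k, Real.exp (ξ * ν t k)) Set.univ := by
  subst hP hQ
  have hroot (t k) : IsSecularRoot μ α t (ν t k) :=
    isSecularRoot_of_eval_eq_zero (StrictAnti.injective fun i j => hμ i j)
      (fun j => (hα j).ne') (hνroot t k)
  rcases eq_or_ne ξ 0 with rfl | hξ
  · refine ⟨by simp [continuous_const], fun N t _ ζ => ?_⟩
    have h := complex_form_nonneg (posSemidef_const (ι := Fin N) (n + 1).cast_nonneg) ζ
    simpa using h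
  constructor
  · have htrace (t) :
        (NormedSpace.exp (ξ • arrowMatrix μ α t)).trace = ∑ k, Real.exp (ξ * ν t k) :=
      trace_exp_eq_sum (lam := fun k => ξ * ν t k)
        (fun i j hij => (hνanti t).injective (mul_left_cancel₀ hξ hij))
        (fun k => arrowVec_ne_zero μ α (ν t k))
        fun k => by rw [smul_mulVec, arrowMatrix_mulVec (hroot t k), smul_smul]
    simp only [← htrace]
    exact (continuous_trace_exp ((continuous_arrowMatrix μ α).const_smul ξ)).continuousOn
  · intro N t _ ζ
    refine complex_form_nonneg
      (K := Matrix.of fun r s => ∑ k, Real.exp (ξ * ν (t r + t s) k)) ?_ ζ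
    have hs : Tendsto (fun m : ℕ => ξ / m) atTop (𝓝 0) := tendsto_const_div_atTop_nhds_zero_nat ξ
    refine posSemidef_of_tendsto (K := fun m => Matrix.of fun r s =>
      (arrowResolvent μ α (ξ / m) (t r + t s) ^ m).trace) ?_ fun r s => ?_
    · filter_upwards [eventually_all.2 fun j => eventually_one_sub_mul_pos hs (μ j),
        eventually_schur_pos μ α hs 0,
        eventually_all.2 fun r => eventually_schur_pos μ α hs (2 * t r)]
        with m h1 h2 h3
      exact posSemidef_arrowResolvent_pow_trace hα h1 h2 h3 m
    · have hlim : Tendsto (fun m : ℕ => ∑ k, ((1 - ξ * ν (t r + t s) k / m)⁻¹) ^ m) atTop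
          (𝓝 (∑ k, Real.exp (ξ * ν (t r + t s) k))) :=
        tendsto_finsetSum _ fun k _ => tendsto_inv_one_sub_div_pow _
      refine hlim.congr' ?_
      filter_upwards [eventually_gt_atTop 0,
        eventually_all.2 fun j => eventually_one_sub_mul_pos hs (μ j),
        eventually_schur_pos μ α hs (t r + t s)] with m hm h1 h2
      have hσ : ξ / m ≠ 0 := div_ne_zero hξ (by positivity)
      rw [of_apply, trace_pow_eq_sum (lam := fun k => (1 - ξ / m * ν (t r + t s) k)⁻¹)
        (fun i j hij => (hνanti (t r + t s)).injective
          (mul_left_cancel₀ hσ (sub_right_injective (inv_injective hij))))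
        (fun k => arrowVec_ne_zero μ _ _)
        fun k => arrowResolvent_mulVec (hroot _ k) (fun j => (h1 j).ne') h2.ne']
      simp only [mul_div_right_comm]
end

section
/- Let f be exponentially convex on an interval (u,v), where −∞ ≤ u < v ≤ +∞, and suppose that for some a, b with −∞ ≤ a < b ≤ +∞ the inequalities u < ν_k(t) < v hold for all t ∈ (a,b) and all k = 0, 1, …, n, where ν_0(t), …, ν_n(t) are the n+1 real roots of the equation P(z) − t·Q(z) = 0. Then the function F(t) = Σ_{k=0}^n f(ν_k(t)) is exponentially convex on (a,b). -/
open Polynomial ComplexOrder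

open Filter Topology

/-- The cone of real polynomials spanned by the products `X ^ e * q ^ 2` of degree at most `D`. -/
noncomputable def stieltjesCone (D : ℕ) : AddSubmonoid ℝ[X] :=
  AddSubmonoid.closure {g | ∃ (e : ℕ) (q : ℝ[X]), e + 2 * q.natDegree ≤ D ∧ g = X ^ e * q ^ 2}

lemma X_pow_mul_sq_mem_stieltjesCone {D e : ℕ} {q : ℝ[X]} (h : e + 2 * q.natDegree ≤ D) :
    X ^ e * q ^ 2 ∈ stieltjesCone D :=
  AddSubmonoid.subset_closure ⟨e, q, h, rfl⟩

lemma stieltjesCone_mono {D E : ℕ} (h : D ≤ E) : stieltjesCone D ≤ stieltjesCone E :=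
  AddSubmonoid.closure_mono fun _ ⟨e, q, hq, hg⟩ => ⟨e, q, hq.trans h, hg⟩

lemma X_add_C_mul_mem_stieltjesCone {D : ℕ} {c : ℝ} (hc : 0 ≤ c) {p : ℝ[X]}
    (hp : p ∈ stieltjesCone D) : (X + C c) * p ∈ stieltjesCone (D + 1) := by
  induction hp using AddSubmonoid.closure_induction with
  | mem g hg =>
    obtain ⟨e, q, hq, rfl⟩ := hg
    have hs : C c = C (√c) ^ 2 := by rw [← C_pow, Real.sq_sqrt hc]
    have : (X + C c) * (X ^ e * q ^ 2) = X ^ (e + 1) * q ^ 2 + X ^ e * (C √c * q) ^ 2 := by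
      rw [hs]; ring
    rw [this]
    have := natDegree_C_mul_le (√c) q
    exact add_mem (X_pow_mul_sq_mem_stieltjesCone (by omega))
      (X_pow_mul_sq_mem_stieltjesCone (by omega))
  | zero => simp
  | add x y _ _ hx hy => rw [mul_add]; exact add_mem hx hy

lemma quadratic_mul_mem_stieltjesCone {D : ℕ} (a b : ℝ) {p : ℝ[X]}
    (hp : p ∈ stieltjesCone D) : ((X - C a) ^ 2 + C b ^ 2) * p ∈ stieltjesCone (D + 2) := by
  induction hp using AddSubmonoid.closure_induction with
  | mem g hg =>
    obtain ⟨e, q, hq, rfl⟩ := hg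
    have : ((X - C a) ^ 2 + C b ^ 2) * (X ^ e * q ^ 2)
        = X ^ e * ((X - C a) * q) ^ 2 + X ^ e * (C b * q) ^ 2 := by ring
    rw [this]
    have h₁ := natDegree_C_mul_le b q
    have h₂ := natDegree_mul_le (p := X - C a) (q := q)
    rw [natDegree_X_sub_C] at h₂
    exact add_mem (X_pow_mul_sq_mem_stieltjesCone (by omega))
      (X_pow_mul_sq_mem_stieltjesCone (by omega))
  | zero => simp
  | add x y _ _ hx hy => rw [mul_add]; exact add_mem hx hy

lemma mem_stieltjesCone_natDegree (p : ℝ[X]) (hp : ∀ y : ℝ, 0 < y → 0 < p.eval y) :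
    p ∈ stieltjesCone p.natDegree := by
  induction hD : p.natDegree using Nat.strong_induction_on generalizing p with
  | _ D ih =>
  have hp0 : p ≠ 0 := by
    rintro rfl
    simpa using hp 1 one_pos
  rcases Nat.eq_zero_or_pos D with rfl | hDpos
  · rw [natDegree_eq_zero] at hD
    obtain ⟨c, rfl⟩ := hD
    have hc : 0 ≤ c := by simpa using (hp 1 one_pos).le
    have : C c = X ^ 0 * (C (√c)) ^ 2 := by
      rw [← C_pow, Real.sq_sqrt hc]; simp
    rw [this]
    exact X_pow_mul_sq_mem_stieltjesCone (by simp)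
  obtain ⟨z, hz⟩ := IsAlgClosed.exists_aeval_eq_zero ℂ p (by
    rw [degree_eq_natDegree hp0, hD]; exact_mod_cast hDpos.ne')
  by_cases him : z.im = 0
  · have hroot : p.IsRoot z.re := by
      have hzr : z = algebraMap ℝ ℂ z.re := Complex.ext (by simp) (by simpa using him)
      rw [hzr, aeval_algebraMap_apply] at hz
      simpa [IsRoot] using hz
    have hre : z.re ≤ 0 := by
      by_contra! h
      exact (hp _ h).ne' hroot
    obtain ⟨q, rfl⟩ := dvd_iff_isRoot.2 hroot
    have hq0 : q ≠ 0 := right_ne_zero_of_mul hp0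
    rw [natDegree_mul (X_sub_C_ne_zero _) hq0, natDegree_X_sub_C] at hD
    have hq := ih q.natDegree (by omega) q (fun y hy => by
      have := hp y hy
      simp only [eval_mul, eval_sub, eval_X, eval_C] at this
      exact pos_of_mul_pos_right this (by linarith)) rfl
    have := X_add_C_mul_mem_stieltjesCone (neg_nonneg.2 hre) hq
    rw [C_neg, ← sub_eq_add_neg] at this
    rwa [← hD, add_comm]
  · obtain ⟨q, hq⟩ := p.quadratic_dvd_of_aeval_eq_zero_im_ne_zero hz him
    have hquad : (X ^ 2 - C (2 * z.re) * X + C (‖z‖ ^ 2) : ℝ[X])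
        = (X - C z.re) ^ 2 + C z.im ^ 2 := by
      rw [Complex.sq_norm, Complex.normSq_apply]
      simp only [C_add, C_mul, ← C_pow]
      simp only [C_pow, C_ofNat]
      ring
    rw [hquad] at hq
    have hdeg : ((X - C z.re) ^ 2 + C z.im ^ 2 : ℝ[X]).natDegree = 2 := by
      rw [← C_pow, natDegree_add_C, natDegree_pow, natDegree_X_sub_C]
    subst hq
    rw [natDegree_mul (left_ne_zero_of_mul hp0) (right_ne_zero_of_mul hp0), hdeg] at hD
    have hq := ih q.natDegree (by omega) q (fun y hy => by
      have := hp y hy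
      rw [eval_mul] at this
      refine pos_of_mul_pos_right this ?_
      simp only [eval_add, eval_pow, eval_sub, eval_X, eval_C]
      positivity) rfl
    have := quadratic_mul_mem_stieltjesCone z.re z.im hq
    rwa [← hD, add_comm]

/-- A polynomial of degree at most `D` that is positive on `(0, ∞)` is a sum of terms
`X ^ e * q ^ 2` of degree at most `D`. -/
lemma mem_stieltjesCone {D : ℕ} {p : ℝ[X]} (hD : p.natDegree ≤ D)
    (hp : ∀ y : ℝ, 0 < y → 0 < p.eval y) : p ∈ stieltjesCone D :=
  stieltjesCone_mono hD (mem_stieltjesCone_natDegree p hp)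

lemma ExpConvexOn.sum_mul_mul_nonneg {f : ℝ → ℝ} {S : Set ℝ} (hf : ExpConvexOn f S) {N : ℕ}
    (t : Fin N → ℝ) (ht : ∀ r s, t r + t s ∈ S) (x : Fin N → ℝ) :
    0 ≤ ∑ r, ∑ s, f (t r + t s) * x r * x s := by
  have := hf.2 N t ht fun r => (x r : ℂ)
  simp only [Complex.conj_ofReal] at this
  exact_mod_cast this

lemma ExpConvexOn.intro {f : ℝ → ℝ} {S : Set ℝ} (hc : ContinuousOn f S)
    (h : ∀ (N : ℕ) (t : Fin N → ℝ), (∀ r s, t r + t s ∈ S) → ∀ x : Fin N → ℝ,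
      0 ≤ ∑ r, ∑ s, f (t r + t s) * x r * x s) : ExpConvexOn f S := by
  refine ⟨hc, fun N t ht ζ => ?_⟩
  have key : ∑ r, ∑ s, (f (t r + t s) : ℂ) * ζ r * (starRingEnd ℂ) (ζ s)
      = (((∑ r, ∑ s, f (t r + t s) * (ζ r).re * (ζ s).re)
        + ∑ r, ∑ s, f (t r + t s) * (ζ r).im * (ζ s).im : ℝ) : ℂ) := by
    apply Complex.ext
    · simp only [Complex.re_sum, Complex.ofReal_re, ← Finset.sum_add_distrib]
      refine Finset.sum_congr rfl fun r _ => Finset.sum_congr rfl fun s _ => ?_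
      simp
    · have hcomm : ∑ r, ∑ s, f (t r + t s) * (ζ r).re * (ζ s).im
          = ∑ r, ∑ s, f (t r + t s) * (ζ r).im * (ζ s).re := by
        rw [Finset.sum_comm]
        refine Finset.sum_congr rfl fun r _ => Finset.sum_congr rfl fun s _ => ?_
        rw [add_comm (t s)]; ring
      rw [Complex.ofReal_im, ← sub_eq_zero.2 hcomm.symm]
      simp only [Complex.im_sum, ← Finset.sum_sub_distrib]
      refine Finset.sum_congr rfl fun r _ => Finset.sum_congr rfl fun s _ => ?_
      simp
      ring
  rw [key]
  exact_mod_cast add_nonneg (h N t ht _) (h N t ht _)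

/-- The linear functional on polynomials sending `X ^ i` to `f (x + h * i)`. -/
noncomputable def latticeFunctional (f : ℝ → ℝ) (x h : ℝ) : ℝ[X] →ₗ[ℝ] ℝ :=
  Polynomial.lsum fun i => f (x + h * i) • LinearMap.id

lemma latticeFunctional_monomial (f : ℝ → ℝ) (x h : ℝ) (i : ℕ) (c : ℝ) :
    latticeFunctional f x h (monomial i c) = f (x + h * i) * c := by
  simp [latticeFunctional, Polynomial.sum_monomial_index]

lemma ExpConvexOn.latticeFunctional_nonneg {f : ℝ → ℝ} {S : Set ℝ} (hf : ExpConvexOn f S)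
    {x h : ℝ} {D : ℕ} (hS : ∀ i ≤ D, x + h * i ∈ S) {p : ℝ[X]} (hp : p ∈ stieltjesCone D) :
    0 ≤ latticeFunctional f x h p := by
  induction hp using AddSubmonoid.closure_induction with
  | mem g hg =>
    obtain ⟨e, q, hq, rfl⟩ := hg
    have hexp : X ^ e * q ^ 2 = ∑ r : Fin (q.natDegree + 1), ∑ s : Fin (q.natDegree + 1),
        monomial (e + r + s) (q.coeff r * q.coeff s) := by
      conv_lhs => rw [sq, q.as_sum_range, Finset.sum_range, Finset.sum_mul_sum, Finset.mul_sum]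
      refine Finset.sum_congr rfl fun r _ => ?_
      rw [Finset.mul_sum]
      refine Finset.sum_congr rfl fun s _ => ?_
      rw [monomial_mul_monomial, X_pow_mul_monomial,
        show (r : ℕ) + s + e = e + r + s by omega]
    have ht : ∀ r s : Fin (q.natDegree + 1),
        ((x + h * e) / 2 + h * r) + ((x + h * e) / 2 + h * s) = x + h * ((e + r + s : ℕ) : ℝ) := by
      intro r s; push_cast; ring
    have := hf.sum_mul_mul_nonneg (fun r : Fin (q.natDegree + 1) => (x + h * e) / 2 + h * r)
      (fun r s => by rw [ht]; exact hS _ (by omega)) fun r => q.coeff r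
    rw [hexp]
    simp only [map_sum, latticeFunctional_monomial]
    simpa only [ht, mul_assoc] using this
  | zero => simp
  | add x y _ _ hx hy => rw [map_add]; exact add_nonneg hx hy

lemma abs_exp_mul_sub_exp_mul_le {c d δ x y : ℝ} (hδ : 0 < δ) (hx : x ∈ Set.Icc (c + δ) (d - δ))
    (hy : y ∈ Set.Icc (c + δ) (d - δ)) (l : ℝ) :
    |Real.exp (l * x) - Real.exp (l * y)|
      ≤ |x - y| / δ * (Real.exp (l * c) + Real.exp (l * d)) := by
  have one : ∀ x y : ℝ, x ∈ Set.Icc (c + δ) (d - δ) →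
      Real.exp (l * x) - Real.exp (l * y)
        ≤ |x - y| / δ * (Real.exp (l * c) + Real.exp (l * d)) := by
    intro x y hx
    have h1 : Real.exp (l * x) - Real.exp (l * y) ≤ |l| * |x - y| * Real.exp (l * x) := by
      have h := Real.add_one_le_exp (l * y - l * x)
      have h2 : Real.exp (l * y) = Real.exp (l * y - l * x) * Real.exp (l * x) := by
        rw [← Real.exp_add]; congr 1; ring
      have h3 : l * (x - y) ≤ |l| * |x - y| := by rw [← abs_mul]; exact le_abs_self _
      rw [h2]
      nlinarith [Real.exp_pos (l * x)]
    have h2 : |l| * δ * Real.exp (l * x) ≤ Real.exp (l * c) + Real.exp (l * d) := by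
      have h3 : |l| * δ ≤ Real.exp (|l| * δ) := by linarith [Real.add_one_le_exp (|l| * δ)]
      have h4 : |l| * δ * Real.exp (l * x) ≤ Real.exp (|l| * δ + l * x) := by
        rw [Real.exp_add]; gcongr
      rcases le_total 0 l with hl | hl
      · have : Real.exp (|l| * δ + l * x) ≤ Real.exp (l * d) := by
          rw [abs_of_nonneg hl]
          gcongr
          nlinarith [hx.2]
        linarith [Real.exp_pos (l * c)]
      · have : Real.exp (|l| * δ + l * x) ≤ Real.exp (l * c) := by
          rw [abs_of_nonpos hl]
          gcongr
          nlinarith [hx.1]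
        linarith [Real.exp_pos (l * d)]
    calc _ ≤ |l| * |x - y| * Real.exp (l * x) := h1
      _ = |x - y| / δ * (|l| * δ * Real.exp (l * x)) := by field_simp
      _ ≤ _ := by gcongr
  rw [abs_le]
  constructor
  · have := one y x hy
    rw [abs_sub_comm] at this
    linarith
  · exact one x y hx

/-- The largest point of the lattice `c + ℕ * h` not exceeding `x`, for `c ≤ x` and `0 < h`. -/
noncomputable def latticeFloor (c h x : ℝ) : ℝ := c + h * (⌊(x - c) / h⌋₊ : ℝ)

lemma abs_latticeFloor_sub_le {c h x : ℝ} (hh : 0 < h) (hx : c ≤ x) :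
    |latticeFloor c h x - x| ≤ h := by
  have h1 := Nat.floor_le (div_nonneg (sub_nonneg.2 hx) hh.le)
  have h2 := Nat.lt_floor_add_one ((x - c) / h)
  rw [le_div_iff₀ hh] at h1
  rw [div_lt_iff₀ hh] at h2
  rw [latticeFloor, abs_le]
  constructor <;> nlinarith

lemma tendsto_latticeFloor {c x : ℝ} (hx : c ≤ x) {h : ℕ → ℝ} (hh : ∀ m, 0 < h m)
    (hlim : Tendsto h atTop (𝓝 0)) :
    Tendsto (fun m => latticeFloor c (h m) x) atTop (𝓝 x) := by
  rw [tendsto_iff_dist_tendsto_zero]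
  exact squeeze_zero (fun _ => dist_nonneg)
    (fun m => by rw [Real.dist_eq]; exact abs_latticeFloor_sub_le (hh m) hx) hlim

/-- A discretised form of the duality between exponentially convex functions and exponential sums
that are nonnegative on the real line. -/
lemma ExpConvexOn.lattice_sum_nonneg {ι : Type*} [Fintype ι] {f : ℝ → ℝ} {S : Set ℝ}
    (hf : ExpConvexOn f S) {c d δ ε h : ℝ} {M : ℕ} (hcd : Set.Icc c d ⊆ S) (hδ : 0 < δ)
    (hh : 0 < h) (hM : c + h * M = d) (w x : ι → ℝ)
    (hx : ∀ i, x i ∈ Set.Icc (c + 2 * δ) (d - 2 * δ)) (hhδ : h ≤ δ)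
    (hε : (∑ i, |w i|) * (h / δ) < ε)
    (hexp : ∀ l, 0 ≤ ∑ i, w i * Real.exp (l * x i)) :
    0 ≤ ∑ i, w i * f (latticeFloor c h (x i)) + ε * (f c + f d) := by
  set k : ι → ℕ := fun i => ⌊(x i - c) / h⌋₊ with hk
  have hkM : ∀ i, k i ≤ M := fun i => by
    refine Nat.floor_le_of_le ?_
    rw [div_le_iff₀ hh]
    linarith [(hx i).2]
  have hcx : ∀ i, c ≤ x i := fun i => by linarith [(hx i).1]
  set p : ℝ[X] := ∑ i, monomial (k i) (w i) + (monomial 0 ε + monomial M ε) with hp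
  have hdeg : p.natDegree ≤ M := by
    refine natDegree_add_le_of_degree_le (natDegree_sum_le_of_forall_le _ _ fun i _ => ?_)
      (natDegree_add_le_of_degree_le ?_ ?_)
    · exact (natDegree_monomial_le _).trans (hkM i)
    · exact (natDegree_monomial_le _).trans (Nat.zero_le _)
    · exact natDegree_monomial_le _
  have hpos : ∀ y : ℝ, 0 < y → 0 < p.eval y := by
    intro y hy
    set l := Real.log y / h with hl
    have hpow : ∀ j : ℕ, Real.exp (l * c) * y ^ j = Real.exp (l * (c + h * j)) := by
      intro j
      rw [mul_add, Real.exp_add]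
      congr 1
      rw [← Real.exp_log hy, ← Real.exp_nat_mul, hl]
      congr 1
      field_simp
    refine pos_of_mul_pos_right ?_ (Real.exp_pos (l * c)).le
    have heval : Real.exp (l * c) * p.eval y
        = ∑ i, w i * Real.exp (l * latticeFloor c h (x i))
          + ε * (Real.exp (l * c) + Real.exp (l * d)) := by
      have h1 : ∀ i, w i * Real.exp (l * latticeFloor c h (x i))
          = Real.exp (l * c) * (w i * y ^ k i) := fun i => by
        rw [latticeFloor, ← hpow]; ring
      simp only [h1, hp, eval_add, eval_finsetSum, eval_monomial, ← hM, ← hpow, ← Finset.mul_sum]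
      ring
    rw [heval]
    have hdiff : |∑ i, w i * Real.exp (l * latticeFloor c h (x i))
        - ∑ i, w i * Real.exp (l * x i)|
        ≤ (∑ i, |w i|) * (h / δ) * (Real.exp (l * c) + Real.exp (l * d)) := by
      rw [← Finset.sum_sub_distrib, mul_assoc, Finset.sum_mul]
      refine (Finset.abs_sum_le_sum_abs _ _).trans (Finset.sum_le_sum fun i _ => ?_)
      rw [← mul_sub, abs_mul]
      have hfl := abs_latticeFloor_sub_le hh (hcx i)
      have hab := abs_le.1 hfl
      have h2 := hx i
      gcongr
      refine (abs_exp_mul_sub_exp_mul_le hδ (c := c) (d := d) ?_ ?_ l).trans ?_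
      · constructor
        · linarith [h2.1]
        · have : latticeFloor c h (x i) ≤ x i := by
            have := Nat.floor_le (div_nonneg (sub_nonneg.2 (hcx i)) hh.le)
            rw [le_div_iff₀ hh] at this
            rw [latticeFloor]
            linarith
          linarith [h2.2]
      · constructor <;> linarith [h2.1, h2.2]
      · gcongr
    have hE : 0 < Real.exp (l * c) + Real.exp (l * d) := by positivity
    have := mul_lt_mul_of_pos_right hε hE
    linarith [(abs_le.1 hdiff).1, hexp l]
  have hd : c ≤ d := by rw [← hM]; nlinarith [hh.le, M.cast_nonneg (α := ℝ)]
  have hlat : ∀ i ≤ M, c + h * i ∈ S := fun i hi => hcd ⟨by nlinarith [i.cast_nonneg (α := ℝ)], by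
    rw [← hM]; gcongr⟩
  have := hf.latticeFunctional_nonneg hlat (mem_stieltjesCone hdeg hpos)
  simp only [hp, map_add, map_sum, latticeFunctional_monomial, hM, CharP.cast_eq_zero, mul_zero,
    add_zero] at this
  convert this using 1
  congr 1
  · exact Finset.sum_congr rfl fun i _ => by rw [latticeFloor, mul_comm]
  · ring

/-- A linear combination of point evaluations that is nonnegative on all exponentials is
nonnegative on all exponentially convex functions. -/
lemma ExpConvexOn.sum_nonneg {ι : Type*} [Fintype ι] {f : ℝ → ℝ} {S : Set ℝ} (hS : IsOpen S)
    (hS' : S.OrdConnected) (hf : ExpConvexOn f S) (w x : ι → ℝ) (hx : ∀ i, x i ∈ S)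
    (hexp : ∀ l, 0 ≤ ∑ i, w i * Real.exp (l * x i)) : 0 ≤ ∑ i, w i * f (x i) := by
  rcases isEmpty_or_nonempty ι with hι | hι
  · simp
  obtain ⟨i₀, hi₀⟩ := Finite.exists_min x
  obtain ⟨i₁, hi₁⟩ := Finite.exists_max x
  obtain ⟨r₀, hr₀, hb₀⟩ := Metric.isOpen_iff.1 hS _ (hx i₀)
  obtain ⟨r₁, hr₁, hb₁⟩ := Metric.isOpen_iff.1 hS _ (hx i₁)
  obtain ⟨δ, hδ, hδr⟩ : ∃ δ : ℝ, 0 < δ ∧ 2 * δ < min r₀ r₁ :=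
    ⟨min r₀ r₁ / 3, by positivity, by linarith [lt_min hr₀ hr₁]⟩
  rw [lt_min_iff] at hδr
  set c := x i₀ - 2 * δ with hc
  set d := x i₁ + 2 * δ with hd
  have hcd : Set.Icc c d ⊆ S := by
    refine hS'.out (hb₀ ?_) (hb₁ ?_)
    · rw [Metric.mem_ball, Real.dist_eq, abs_lt]; constructor <;> linarith
    · rw [Metric.mem_ball, Real.dist_eq, abs_lt]; constructor <;> linarith
  have hlt : c < d := by linarith [hi₀ i₁]
  have hx' : ∀ i, x i ∈ Set.Icc (c + 2 * δ) (d - 2 * δ) := fun i =>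
    ⟨by linarith [hi₀ i], by linarith [hi₁ i]⟩
  set h : ℕ → ℝ := fun m => (d - c) * (1 / ((m : ℝ) + 1)) with hh
  have hpos : ∀ m, 0 < h m := fun m => mul_pos (sub_pos.2 hlt) (by positivity)
  have hlim : Tendsto h atTop (𝓝 0) := by
    simpa [hh] using (tendsto_one_div_add_atTop_nhds_zero_nat (𝕜 := ℝ)).const_mul (d - c)
  have hsum : Tendsto (fun m => ∑ i, w i * f (latticeFloor c (h m) (x i))) atTop
      (𝓝 (∑ i, w i * f (x i))) := by
    refine tendsto_finsetSum _ fun i _ => Tendsto.const_mul _ ?_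
    exact ((hf.1.continuousAt (hS.mem_nhds (hx i))).tendsto).comp
      (tendsto_latticeFloor (by linarith [(hx' i).1]) hpos hlim)
  have hε : ∀ ε > 0, 0 ≤ ∑ i, w i * f (x i) + ε * (f c + f d) := by
    intro ε hε
    refine ge_of_tendsto (hsum.add_const _) ?_
    have hlim' : Tendsto (fun m => (∑ i, |w i|) * (h m / δ)) atTop (𝓝 0) := by
      simpa using (hlim.div_const δ).const_mul (∑ i, |w i|)
    filter_upwards [hlim.eventually_le_const hδ, hlim'.eventually_lt_const hε] with m h1 h2
    refine hf.lattice_sum_nonneg (M := m + 1) hcd hδ (hpos m) ?_ w x hx' h1 h2 hexp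
    have : (m : ℝ) + 1 ≠ 0 := by positivity
    simp only [hh]
    push_cast
    field_simp
    ring
  have hlim : Tendsto (fun ε : ℝ => ∑ i, w i * f (x i) + ε * (f c + f d)) (𝓝[>] 0)
      (𝓝 (∑ i, w i * f (x i) + 0 * (f c + f d))) :=
    tendsto_nhdsWithin_of_tendsto_nhds (Continuous.tendsto (by fun_prop) 0)
  rw [zero_mul, add_zero] at hlim
  exact ge_of_tendsto hlim (eventually_mem_nhdsWithin.mono hε)

section ExpLimit

variable {𝔸 : Type*} [NormedRing 𝔸]

lemma norm_pow_sub_pow_le [NormOneClass 𝔸] {a b : 𝔸} {K : ℝ} (hK : 1 ≤ K) (ha : ‖a‖ ≤ K)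
    (hb : ‖b‖ ≤ K) (m : ℕ) : ‖a ^ m - b ^ m‖ ≤ m * ‖a - b‖ * K ^ m := by
  induction m with
  | zero => simp
  | succ m ih =>
    have h : a ^ (m + 1) - b ^ (m + 1) = a ^ m * (a - b) + (a ^ m - b ^ m) * b := by
      rw [pow_succ, pow_succ]; noncomm_ring
    have h1 : ‖a ^ m * (a - b)‖ ≤ ‖a - b‖ * K ^ (m + 1) := by
      calc _ ≤ ‖a ^ m‖ * ‖a - b‖ := norm_mul_le _ _
        _ ≤ K ^ m * ‖a - b‖ := by
          gcongr
          exact (norm_pow_le a m).trans (by gcongr)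
        _ ≤ K ^ (m + 1) * ‖a - b‖ := by gcongr; omega
        _ = _ := mul_comm _ _
    have h2 : ‖(a ^ m - b ^ m) * b‖ ≤ m * ‖a - b‖ * K ^ (m + 1) := by
      calc _ ≤ ‖a ^ m - b ^ m‖ * ‖b‖ := norm_mul_le _ _
        _ ≤ (m * ‖a - b‖ * K ^ m) * K := by gcongr
        _ = _ := by ring
    rw [h]
    refine (norm_add_le _ _).trans ((add_le_add h1 h2).trans_eq ?_)
    push_cast
    ring

variable [NormedAlgebra ℝ 𝔸]

lemma norm_le_exp_div [NormOneClass 𝔸] {a : 𝔸} {C : ℝ} {m : ℕ} (hm : 0 < m)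
    (h : ‖(m : ℝ) • (a - 1)‖ ≤ C) : ‖a‖ ≤ Real.exp (C / m) := by
  have hm' : (0 : ℝ) < m := by exact_mod_cast hm
  rw [norm_smul, Real.norm_natCast] at h
  have h1 : ‖a - 1‖ ≤ C / m := by rwa [le_div_iff₀' hm']
  have h2 : ‖a‖ ≤ ‖a - 1‖ + 1 := by
    simpa using norm_add_le (a - 1) 1
  linarith [Real.add_one_le_exp (C / m)]

variable [CompleteSpace 𝔸]

lemma tendsto_smul_exp_inv_smul_sub_one (z : 𝔸) :
    Tendsto (fun m : ℕ => (m : ℝ) • (NormedSpace.exp ((m : ℝ)⁻¹ • z) - 1)) atTop (𝓝 z) := by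
  have h := (hasDerivAt_exp_smul_const (𝕂 := ℝ) z 0).tendsto_slope_zero
  have hinv : Tendsto (fun m : ℕ => (m : ℝ)⁻¹) atTop (𝓝[≠] 0) :=
    tendsto_nhdsWithin_iff.2 ⟨tendsto_inv_atTop_nhds_zero_nat,
      (eventually_gt_atTop 0).mono fun m hm => by
        simpa using hm.ne'⟩
  simpa [Function.comp_def] using h.comp hinv

/-- If `m • (a m - 1)` converges to `z`, then `a m ^ m` converges to `exp z`. -/
lemma tendsto_pow_exp_of_tendsto_smul_sub_one [NormOneClass 𝔸] {a : ℕ → 𝔸} {z : 𝔸}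
    (h : Tendsto (fun m : ℕ => (m : ℝ) • (a m - 1)) atTop (𝓝 z)) :
    Tendsto (fun m => a m ^ m) atTop (𝓝 (NormedSpace.exp z)) := by
  set b : ℕ → 𝔸 := fun m => NormedSpace.exp ((m : ℝ)⁻¹ • z) with hb
  have hbz : Tendsto (fun m : ℕ => (m : ℝ) • (b m - 1)) atTop (𝓝 z) :=
    tendsto_smul_exp_inv_smul_sub_one z
  have hz : ‖z‖ < ‖z‖ + 1 := by linarith
  set C := ‖z‖ + 1
  have hlim : Tendsto (fun m : ℕ => ‖(m : ℝ) • (a m - 1) - (m : ℝ) • (b m - 1)‖ * Real.exp C)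
      atTop (𝓝 0) := by
    simpa using (h.sub hbz).norm.mul_const (Real.exp C)
  rw [tendsto_iff_norm_sub_tendsto_zero]
  refine squeeze_zero' (Eventually.of_forall fun _ => norm_nonneg _) ?_ hlim
  filter_upwards [h.norm.eventually_le_const hz, hbz.norm.eventually_le_const hz,
    eventually_gt_atTop 0] with m ha hbm hm
  have hm' : (0 : ℝ) < m := by exact_mod_cast hm
  have hpow : b m ^ m = NormedSpace.exp z := by
    have : NormedAlgebra ℚ 𝔸 := NormedAlgebra.restrictScalars ℚ ℝ 𝔸
    rw [hb, ← NormedSpace.exp_nsmul, ← Nat.cast_smul_eq_nsmul ℝ, smul_smul,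
      mul_inv_cancel₀ hm'.ne', one_smul]
  have hexp : Real.exp (C / m) ^ m = Real.exp C := by
    rw [← Real.exp_nat_mul]; congr 1; field_simp
  rw [← hpow, ← smul_sub, sub_sub_sub_cancel_right, norm_smul, Real.norm_natCast, ← hexp]
  exact norm_pow_sub_pow_le (Real.one_le_exp (div_nonneg (by positivity) hm'.le))
    (norm_le_exp_div hm ha) (norm_le_exp_div hm hbm) m

/-- A variant of the Lie product formula. -/
lemma tendsto_exp_mul_one_add_pow [NormOneClass 𝔸] (x y : 𝔸) :
    Tendsto (fun m : ℕ => (NormedSpace.exp ((m : ℝ)⁻¹ • x) * (1 + (m : ℝ)⁻¹ • y)) ^ m) atTop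
      (𝓝 (NormedSpace.exp (x + y))) := by
  apply tendsto_pow_exp_of_tendsto_smul_sub_one
  have hx := tendsto_smul_exp_inv_smul_sub_one x
  have hone : Tendsto (fun m : ℕ => NormedSpace.exp ((m : ℝ)⁻¹ • x)) atTop (𝓝 1) := by
    have h0 : Tendsto (fun m : ℕ => (m : ℝ)⁻¹) atTop (𝓝 0) := tendsto_inv_atTop_nhds_zero_nat
    have := (hasDerivAt_exp_smul_const (𝕂 := ℝ) x 0).continuousAt.tendsto.comp h0
    simpa [Function.comp_def] using this
  have := hx.add (hone.mul_const y)
  rw [one_mul] at this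
  refine this.congr' ?_
  filter_upwards [eventually_gt_atTop 0] with m hm
  have hm' : (m : ℝ) ≠ 0 := by exact_mod_cast hm.ne'
  rw [mul_add, mul_one, mul_smul_comm, add_sub_right_comm, smul_add, smul_smul,
    mul_inv_cancel₀ hm', one_smul]

end ExpLimit

open scoped Matrix.Norms.Operator in
lemma Matrix.tendsto_exp_mul_one_add_pow {ι : Type*} [Fintype ι] [DecidableEq ι] [Nonempty ι]
    (x y : Matrix ι ι ℝ) :
    Tendsto (fun m : ℕ => (NormedSpace.exp ((m : ℝ)⁻¹ • x) * (1 + (m : ℝ)⁻¹ • y)) ^ m) atTop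
      (𝓝 (NormedSpace.exp (x + y))) :=
  _root_.tendsto_exp_mul_one_add_pow x y

lemma Matrix.exp_diagonal_real {ι : Type*} [Fintype ι] [DecidableEq ι] (v : ι → ℝ) :
    NormedSpace.exp (Matrix.diagonal v) = Matrix.diagonal fun i => Real.exp (v i) := by
  rw [Matrix.exp_diagonal, Real.exp_eq_exp_ℝ, Pi.exp_def]

/-- The trace of the exponential of a matrix with distinct eigenvalues. -/
lemma Matrix.trace_exp_of_eigenvectors {ι κ : Type*} [Fintype ι] [DecidableEq ι] [Fintype κ]
    (hcard : Fintype.card ι = Fintype.card κ) (A : Matrix ι ι ℝ) (ν : κ → ℝ)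
    (hν : Function.Injective ν) (v : κ → ι → ℝ) (hv : ∀ k, v k ≠ 0)
    (hA : ∀ k, A.mulVec (v k) = ν k • v k) (l : ℝ) :
    (NormedSpace.exp (l • A)).trace = ∑ k, Real.exp (l * ν k) := by
  obtain ⟨e⟩ := Fintype.card_eq.1 hcard
  have hlin : LinearIndependent ℝ (fun i => v (e i)) :=
    Module.End.eigenvectors_linearIndependent' (Matrix.toLin' A) (fun i => ν (e i))
      (hν.comp e.injective) _ fun i => by
        rw [Module.End.hasEigenvector_iff, Module.End.mem_eigenspace_iff, Matrix.toLin'_apply]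
        exact ⟨hA _, hv _⟩
  set V : Matrix ι ι ℝ := Matrix.of fun i k => v (e k) i with hV
  have hunit : IsUnit V := Matrix.linearIndependent_cols_iff_isUnit.1 hlin
  have hdet : IsUnit V.det := (Matrix.isUnit_iff_isUnit_det V).1 hunit
  have hAV : A * V = V * Matrix.diagonal fun i => ν (e i) := by
    ext i k
    rw [Matrix.mul_diagonal]
    have := congrFun (hA (e k)) i
    simpa [Matrix.mul_apply, Matrix.mulVec, dotProduct, hV, mul_comm] using this
  have hdec : l • A = V * (Matrix.diagonal fun i => l * ν (e i)) * V⁻¹ := by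
    have : (Matrix.diagonal fun i => l * ν (e i)) = l • Matrix.diagonal fun i => ν (e i) := by
      rw [← Matrix.diagonal_smul]; rfl
    rw [this, Matrix.mul_smul, ← hAV, Matrix.smul_mul, Matrix.mul_nonsing_inv_cancel_right _ _ hdet]
  rw [hdec, Matrix.exp_conj _ _ hunit, Matrix.trace_mul_cycle, Matrix.nonsing_inv_mul _ hdet,
    one_mul, Matrix.exp_diagonal_real, Matrix.trace_diagonal]
  exact e.sum_comp fun k => Real.exp (l * ν k)

/-- The functions `t ↦ c * exp (a * t)` with `0 ≤ c`. -/
def expMonomials : Submonoid (ℝ → ℝ) where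
  carrier := {g | ∃ c a : ℝ, 0 ≤ c ∧ g = fun t => c * Real.exp (a * t)}
  one_mem' := ⟨1, 0, zero_le_one, by ext; simp⟩
  mul_mem' := by
    rintro _ _ ⟨c, a, hc, rfl⟩ ⟨c', a', hc', rfl⟩
    refine ⟨c * c', a + a', mul_nonneg hc hc', ?_⟩
    ext t
    rw [Pi.mul_apply, add_mul, Real.exp_add]
    ring

/-- Sums of exponential functions with nonnegative coefficients. -/
def expSums : Subsemiring (ℝ → ℝ) := expMonomials.subsemiringClosure

lemma mul_exp_mem_expSums {c : ℝ} (hc : 0 ≤ c) (a : ℝ) :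
    (fun t => c * Real.exp (a * t)) ∈ expSums :=
  AddSubmonoid.subset_closure ⟨c, a, hc, rfl⟩

lemma const_mem_expSums {c : ℝ} (hc : 0 ≤ c) : (fun _ => c) ∈ expSums := by
  simpa using mul_exp_mem_expSums hc 0

lemma sum_mul_mul_nonneg_of_mem_expSums {g : ℝ → ℝ} (hg : g ∈ expSums) {N : ℕ}
    (t x : Fin N → ℝ) : 0 ≤ ∑ r, ∑ s, g (t r + t s) * x r * x s := by
  induction (hg : g ∈ AddSubmonoid.closure (expMonomials : Set (ℝ → ℝ))) using
    AddSubmonoid.closure_induction with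
  | mem g hg =>
    obtain ⟨c, a, hc, rfl⟩ := hg
    have : ∑ r, ∑ s, c * Real.exp (a * (t r + t s)) * x r * x s
        = c * (∑ r, Real.exp (a * t r) * x r) ^ 2 := by
      rw [sq, Finset.sum_mul_sum, Finset.mul_sum]
      refine Finset.sum_congr rfl fun r _ => ?_
      rw [Finset.mul_sum]
      refine Finset.sum_congr rfl fun s _ => ?_
      rw [mul_add, Real.exp_add]
      ring
    rw [this]
    positivity
  | zero => simp
  | add g₁ g₂ _ _ h₁ h₂ =>
    simp only [Pi.add_apply, add_mul, Finset.sum_add_distrib]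
    exact add_nonneg h₁ h₂

lemma pow_apply_mem_expSums {ι : Type*} [Fintype ι] [DecidableEq ι] {A : ℝ → Matrix ι ι ℝ}
    (hA : ∀ i j, (fun t => A t i j) ∈ expSums) (m : ℕ) (i j : ι) :
    (fun t => (A t ^ m) i j) ∈ expSums := by
  induction m generalizing i j with
  | zero =>
    simp only [pow_zero]
    refine const_mem_expSums ?_
    rw [Matrix.one_apply]
    split_ifs <;> norm_num
  | succ m ih =>
    have : (fun t => (A t ^ (m + 1)) i j)
        = ∑ k, (fun t => (A t ^ m) i k) * fun t => A t k j := by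
      ext t
      simp [pow_succ, Matrix.mul_apply]
    rw [this]
    exact sum_mem fun k _ => mul_mem (ih i k) (hA k j)

/-- If `O` has nonnegative entries and `D t` is diagonal and affine in `t`, then the kernel
`(t, s) ↦ trace (exp (D (t + s) + O))` has nonnegative quadratic forms. -/
lemma sum_mul_mul_trace_exp_nonneg {ι : Type*} [Fintype ι] [DecidableEq ι] [Nonempty ι]
    (p q : ι → ℝ) {O : Matrix ι ι ℝ} (hO : ∀ i j, 0 ≤ O i j) {N : ℕ} (t x : Fin N → ℝ) :
    0 ≤ ∑ r, ∑ s, (NormedSpace.exp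
      (Matrix.diagonal (fun i => p i * (t r + t s) + q i) + O)).trace * x r * x s := by
  set A : ℕ → ℝ → Matrix ι ι ℝ := fun m t =>
    NormedSpace.exp ((m : ℝ)⁻¹ • Matrix.diagonal fun i => p i * t + q i) * (1 + (m : ℝ)⁻¹ • O)
    with hA
  have hlim : ∀ t, Tendsto (fun m => (A m t ^ m).trace) atTop
      (𝓝 (NormedSpace.exp (Matrix.diagonal (fun i => p i * t + q i) + O)).trace) := fun t =>
    ((continuous_id.matrix_trace).tendsto _).comp (Matrix.tendsto_exp_mul_one_add_pow _ _)
  refine ge_of_tendsto' (tendsto_finsetSum _ fun r _ => tendsto_finsetSum _ fun s _ =>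
    ((hlim (t r + t s)).mul_const (x r)).mul_const (x s)) fun m => ?_
  refine sum_mul_mul_nonneg_of_mem_expSums (g := fun t => (A m t ^ m).trace) ?_ t x
  have hentry : ∀ i j, (fun t => A m t i j) ∈ expSums := by
    intro i j
    have : (fun t => A m t i j) = fun t => (Real.exp ((m : ℝ)⁻¹ * q i)
        * (1 + (m : ℝ)⁻¹ • O) i j) * Real.exp (((m : ℝ)⁻¹ * p i) * t) := by
      ext t
      simp only [hA]
      rw [← Matrix.diagonal_smul, Matrix.exp_diagonal_real, Matrix.diagonal_mul, Pi.smul_apply,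
        smul_eq_mul, mul_add, Real.exp_add, ← mul_assoc]
      ring
    rw [this]
    refine mul_exp_mem_expSums (mul_nonneg (Real.exp_pos _).le (add_nonneg ?_ ?_)) _
    · rw [Matrix.one_apply]
      split_ifs <;> norm_num
    · exact mul_nonneg (by positivity) (hO i j)
  have htr : (fun t => (A m t ^ m).trace) = ∑ i, fun t => (A m t ^ m) i i := by
    ext t
    simp [Matrix.trace]
  rw [htr]
  exact sum_mem fun i _ => pow_apply_mem_expSums hentry m i i

lemma StrictMono.fin_eq_id {N : ℕ} {σ : Fin N → Fin N} (h : StrictMono σ) : σ = id :=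
  (h.range_inj strictMono_id).1
    (by rw [(Finite.surjective_of_injective h.injective).range_eq, Set.range_id])

/-- The ordered roots of a pointwise continuous family of monic polynomials with simple real roots
are continuous. -/
lemma continuous_ordered_roots {N : ℕ} {g : ℝ → ℝ → ℝ} (hg : ∀ x, Continuous fun t => g t x)
    {ν : ℝ → Fin N → ℝ} (hν : ∀ t, StrictAnti (ν t)) (hprod : ∀ t x, g t x = ∏ k, (x - ν t k))
    (k : Fin N) : Continuous fun t => ν t k := by
  rw [continuous_iff_continuousAt]
  intro t₀
  rw [ContinuousAt, Metric.tendsto_nhds]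
  intro ε hε
  obtain ⟨δ, hδ, hδε, hgap⟩ : ∃ δ > 0, δ < ε ∧
      ∀ i j : Fin N, i < j → 2 * δ < ν t₀ i - ν t₀ j := by
    have h1 : ∀ i j : Fin N, ∀ᶠ δ : ℝ in 𝓝[>] 0, i < j → 2 * δ < ν t₀ i - ν t₀ j := by
      intro i j
      by_cases hij : i < j
      · have hpos : (2 : ℝ) * 0 < ν t₀ i - ν t₀ j := by linarith [hν t₀ hij]
        have : Tendsto (fun δ : ℝ => 2 * δ) (𝓝[>] 0) (𝓝 (2 * 0)) :=
          tendsto_nhdsWithin_of_tendsto_nhds (Continuous.tendsto (by fun_prop) 0)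
        exact (this.eventually_lt_const hpos).mono fun δ h _ => h
      · exact Eventually.of_forall fun δ h => absurd h hij
    have h2 := eventually_all.2 fun i => eventually_all.2 (h1 i)
    have h3 : ∀ᶠ δ : ℝ in 𝓝[>] 0, δ ∈ Set.Ioo 0 ε := Ioo_mem_nhdsGT hε
    obtain ⟨δ, h, h'⟩ := (h3.and h2).exists
    exact ⟨δ, h.1, h.2, h'⟩
  have hneg : ∀ j, g t₀ (ν t₀ j - δ) * g t₀ (ν t₀ j + δ) < 0 := by
    intro j
    rw [hprod, hprod, ← Finset.prod_mul_distrib, ← Finset.mul_prod_erase _ _ (Finset.mem_univ j)]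
    refine mul_neg_of_neg_of_pos (by nlinarith) (Finset.prod_pos fun i hi => ?_)
    rcases lt_or_gt_of_ne (Finset.ne_of_mem_erase hi) with h | h
    · have := hgap _ _ h
      exact mul_pos_of_neg_of_neg (by linarith) (by linarith)
    · have := hgap _ _ h
      exact mul_pos (by linarith) (by linarith)
  have hev : ∀ᶠ t in 𝓝 t₀, ∀ j, g t (ν t₀ j - δ) * g t (ν t₀ j + δ) < 0 :=
    eventually_all.2 fun j =>
      (((hg _).mul (hg _)).tendsto t₀).eventually_lt_const (hneg j)
  filter_upwards [hev] with t ht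
  have hex : ∀ j, ∃ i, ν t₀ j - δ < ν t i ∧ ν t i < ν t₀ j + δ := by
    intro j
    by_contra! hcon
    refine (ht j).not_ge ?_
    rw [hprod, hprod, ← Finset.prod_mul_distrib]
    refine Finset.prod_nonneg fun i _ => ?_
    rcases le_or_gt (ν t i) (ν t₀ j - δ) with h | h
    · exact mul_nonneg (by linarith) (by linarith)
    · have := hcon i h
      exact mul_nonneg_of_nonpos_of_nonpos (by linarith) (by linarith)
  choose σ hσ using hex
  have hσid : σ = id := StrictMono.fin_eq_id fun i j hij => by
    rw [← (hν t).lt_iff_gt]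
    linarith [(hσ i).1, (hσ j).2, hgap i j hij]
  have hk := hσ k
  rw [hσid, id] at hk
  rw [Real.dist_eq, abs_lt]
  constructor <;> linarith

/-- The symmetric matrix coupling the vertex `none` of a star to its leaves `some k` with
weights `β k`. -/
def starCoupling {n : ℕ} (β : Fin n → ℝ) : Matrix (Option (Fin n)) (Option (Fin n)) ℝ :=
  Matrix.of fun i j => match i, j with
    | none, some k => β k
    | some k, none => β k
    | _, _ => 0

lemma star_mulVec_eigenvector {n : ℕ} (μ β : Fin n → ℝ) {t z : ℝ} (hz : ∀ k, z ≠ μ k)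
    (heq : t + ∑ k, β k ^ 2 / (z - μ k) = z) :
    (Matrix.diagonal (fun o : Option (Fin n) => o.elim t μ) + starCoupling β).mulVec
      (fun o => o.elim 1 fun k => β k / (z - μ k))
      = z • fun o : Option (Fin n) => o.elim 1 fun k => β k / (z - μ k) := by
  ext o
  rw [Matrix.add_mulVec, Pi.add_apply, Matrix.mulVec_diagonal]
  cases o with
  | none =>
    simp only [Matrix.mulVec, dotProduct, starCoupling, Matrix.of_apply, Fintype.sum_option,
      Option.elim, Pi.smul_apply, smul_eq_mul, mul_one, zero_add]
    rw [← heq]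
    congr 1
    rw [heq]
    exact Finset.sum_congr rfl fun k _ => by ring
  | some k =>
    have hk : z - μ k ≠ 0 := sub_ne_zero.2 (hz k)
    simp only [Matrix.mulVec, dotProduct, starCoupling, Matrix.of_apply, Fintype.sum_option,
      Option.elim, Pi.smul_apply, smul_eq_mul, mul_one, zero_mul, Finset.sum_const_zero, add_zero]
    field_simp
    ring

/-- If `ν t` lists the solutions of `z - ∑ α k / (z - μ k) = t`, then the kernel
`(t, s) ↦ ∑ k, exp (l * ν (t + s) k)` has nonnegative quadratic forms. -/
lemma sum_mul_mul_sum_exp_nonneg {n : ℕ} (μ α : Fin n → ℝ) (hα : ∀ k, 0 ≤ α k)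
    (ν : ℝ → Fin (n + 1) → ℝ) (hinj : ∀ t, Function.Injective (ν t))
    (hne : ∀ t k j, ν t k ≠ μ j) (heq : ∀ t k, t + ∑ j, α j / (ν t k - μ j) = ν t k)
    (l : ℝ) {N : ℕ} (t x : Fin N → ℝ) :
    0 ≤ ∑ r, ∑ s, (∑ k, Real.exp (l * ν (t r + t s) k)) * x r * x s := by
  obtain ⟨β, hβ, hlβ⟩ : ∃ β : Fin n → ℝ, (∀ k, β k ^ 2 = α k) ∧ ∀ k, 0 ≤ l * β k := by
    rcases le_total 0 l with hl | hl
    · exact ⟨fun k => √(α k), fun k => Real.sq_sqrt (hα k),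
        fun k => mul_nonneg hl (Real.sqrt_nonneg _)⟩
    · exact ⟨fun k => -√(α k), fun k => by rw [neg_sq, Real.sq_sqrt (hα k)],
        fun k => mul_nonneg_of_nonpos_of_nonpos hl (neg_nonpos.2 (Real.sqrt_nonneg _))⟩
  have htrace : ∀ t, ∑ k, Real.exp (l * ν t k) = (NormedSpace.exp
      (Matrix.diagonal (fun o : Option (Fin n) => l * o.elim 1 0 * t + l * o.elim 0 μ)
        + l • starCoupling β)).trace := by
    intro t
    rw [← Matrix.trace_exp_of_eigenvectors (by simp)
      (Matrix.diagonal (fun o : Option (Fin n) => o.elim t μ) + starCoupling β) (ν t) (hinj t) _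
      (fun k h => one_ne_zero (congrFun h none))
      (fun k => star_mulVec_eigenvector μ β (hne t k) (by simpa only [hβ] using heq t k)),
      smul_add, ← Matrix.diagonal_smul]
    congr 4
    ext o
    cases o <;> simp
  simp only [htrace]
  refine sum_mul_mul_trace_exp_nonneg _ _ (fun i j => ?_) t x
  rcases i with _ | i <;> rcases j with _ | j <;> simp [starCoupling, hlβ]

section Secular

variable {n : ℕ} {μ α : Fin n → ℝ}

lemma eval_secular (t z : ℝ) :
    ((X * ∏ k, (X - C (μ k)) - ∑ k, C (α k) * ∏ j ∈ Finset.univ.erase k, (X - C (μ j)))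
      - C t * ∏ k, (X - C (μ k))).eval z
      = (z - t) * ∏ k, (z - μ k) - ∑ k, α k * ∏ j ∈ Finset.univ.erase k, (z - μ j) := by
  simp only [eval_sub, eval_mul, eval_X, eval_prod, eval_C, eval_finsetSum]
  ring

lemma ne_pole_of_secular_eq_zero (hμ : Function.Injective μ) (hα : ∀ k, 0 < α k) {t z : ℝ}
    (h : (z - t) * ∏ k, (z - μ k) - ∑ k, α k * ∏ j ∈ Finset.univ.erase k, (z - μ j) = 0)
    (k : Fin n) : z ≠ μ k := by
  rintro rfl
  rw [Finset.prod_eq_zero (Finset.mem_univ k) (sub_self _), mul_zero, zero_sub, neg_eq_zero,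
    Finset.sum_eq_single k (fun j _ hj => by
      rw [Finset.prod_eq_zero (Finset.mem_erase.2 ⟨hj.symm, Finset.mem_univ k⟩) (sub_self _),
        mul_zero]) (by simp)] at h
  refine mul_ne_zero (hα k).ne' (Finset.prod_ne_zero_iff.2 fun j hj => ?_) h
  exact sub_ne_zero.2 (hμ.ne (Finset.ne_of_mem_erase hj).symm)

lemma add_sum_div_of_secular_eq_zero {t z : ℝ} (hz : ∀ k, z ≠ μ k)
    (h : (z - t) * ∏ k, (z - μ k) - ∑ k, α k * ∏ j ∈ Finset.univ.erase k, (z - μ j) = 0) :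
    t + ∑ k, α k / (z - μ k) = z := by
  have hQ : ∏ k, (z - μ k) ≠ 0 := Finset.prod_ne_zero_iff.2 fun k _ => sub_ne_zero.2 (hz k)
  have hsum : ∑ k, α k * ∏ j ∈ Finset.univ.erase k, (z - μ j)
      = (∑ k, α k / (z - μ k)) * ∏ k, (z - μ k) := by
    rw [Finset.sum_mul]
    refine Finset.sum_congr rfl fun k _ => ?_
    rw [← Finset.mul_prod_erase _ _ (Finset.mem_univ k), ← mul_assoc,
      div_mul_cancel₀ _ (sub_ne_zero.2 (hz k))]
  rw [hsum, ← sub_mul] at h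
  linarith [(mul_eq_zero.1 h).resolve_right hQ]

lemma secular_eq_prod (t : ℝ) {ν : Fin (n + 1) → ℝ} (hν : Function.Injective ν)
    (hroot : ∀ k, ((X * ∏ k, (X - C (μ k))
      - ∑ k, C (α k) * ∏ j ∈ Finset.univ.erase k, (X - C (μ j)))
      - C t * ∏ k, (X - C (μ k))).eval (ν k) = 0) :
    (X * ∏ k, (X - C (μ k)) - ∑ k, C (α k) * ∏ j ∈ Finset.univ.erase k, (X - C (μ j)))
      - C t * ∏ k, (X - C (μ k)) = ∏ k, (X - C (ν k)) := by
  have hdeg : ∀ s : Finset (Fin n), (∏ k ∈ s, (X - C (μ k))).degree = (s.card : WithBot ℕ) :=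
      fun s => by
    rw [degree_prod]; simp
  have hmonic : ((X - C t) * ∏ k, (X - C (μ k))).Monic :=
    (monic_X_sub_C t).mul (monic_prod_of_monic _ _ fun k _ => monic_X_sub_C _)
  have hmaindeg : ((X - C t) * ∏ k, (X - C (μ k))).degree = ((n + 1 : ℕ) : WithBot ℕ) := by
    rw [degree_mul, degree_X_sub_C, hdeg, Finset.card_univ, Fintype.card_fin]
    push_cast
    rw [add_comm]
  have hlt : (∑ k, C (α k) * ∏ j ∈ Finset.univ.erase k, (X - C (μ j))).degree
      < ((X - C t) * ∏ k, (X - C (μ k))).degree := by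
    rw [hmaindeg]
    refine (degree_sum_le _ _).trans_lt ((Finset.sup_lt_iff (by simp)).2 fun k _ => ?_)
    rw [C_mul']
    refine (degree_smul_le _ _).trans_lt ?_
    rw [hdeg]
    have := Finset.card_le_univ (Finset.univ.erase k)
    rw [Fintype.card_fin] at this
    exact_mod_cast Nat.lt_succ_of_le this
  have hνmonic : (∏ k, (X - C (ν k))).Monic := monic_prod_of_monic _ _ fun k _ => monic_X_sub_C _
  have hνdeg : (∏ k, (X - C (ν k))).degree = ((n + 1 : ℕ) : WithBot ℕ) := by
    rw [degree_prod]; simp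
  have hrw : (X * ∏ k, (X - C (μ k)) - ∑ k, C (α k) * ∏ j ∈ Finset.univ.erase k, (X - C (μ j)))
      - C t * ∏ k, (X - C (μ k))
      = (X - C t) * ∏ k, (X - C (μ k))
        - ∑ k, C (α k) * ∏ j ∈ Finset.univ.erase k, (X - C (μ j)) := by
    ring
  have hfdeg := (degree_sub_eq_left_of_degree_lt hlt).trans hmaindeg
  have hfmonic := hmonic.sub_of_left hlt
  rw [← hrw] at hfdeg hfmonic
  refine eq_of_degree_le_of_eval_index_eq (v := ν) Finset.univ hν.injOn
    (by simp [hfdeg]) (hfdeg.trans hνdeg.symm)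
    (hfmonic.leadingCoeff.trans hνmonic.leadingCoeff.symm) fun k _ => ?_
  rw [hroot, eval_prod]
  exact (Finset.prod_eq_zero (Finset.mem_univ k) (by simp)).symm

end Secular

theorem stmt_1 (n : ℕ) (hn : 1 ≤ n) (μ α : Fin n → ℝ)
    (hμ : ∀ i j : Fin n, i < j → μ j < μ i) (hα : ∀ k, 0 < α k)
    (Q P : Polynomial ℝ)
    (hQ : Q = ∏ k, (X - C (μ k)))
    (hP : P = X * Q - ∑ k, C (α k) * ∏ j ∈ Finset.univ.erase k, (X - C (μ j)))
    (ν : ℝ → Fin (n + 1) → ℝ)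
    (hνroot : ∀ t k, (P - C t * Q).eval (ν t k) = 0)
    (hνanti : ∀ t, StrictAnti (ν t))
    (u v : EReal) (huv : u < v)
    (f : ℝ → ℝ) (hf : ExpConvexOn f {x : ℝ | u < (x : EReal) ∧ (x : EReal) < v})
    (a b : EReal) (hab : a < b)
    (hν : ∀ t : ℝ, a < (t : EReal) → (t : EReal) < b →
      ∀ k, u < (ν t k : EReal) ∧ (ν t k : EReal) < v) :
    ExpConvexOn (fun t => ∑ k, f (ν t k))
      {t : ℝ | a < (t : EReal) ∧ (t : EReal) < b} := by
  subst hP hQ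
  have hμinj : Function.Injective μ := (show StrictAnti μ from fun i j => hμ i j).injective
  have hsec : ∀ t k, (ν t k - t) * ∏ j, (ν t k - μ j)
      - ∑ i, α i * ∏ j ∈ Finset.univ.erase i, (ν t k - μ j) = 0 := fun t k => by
    rw [← eval_secular]; exact hνroot t k
  have hne : ∀ t k j, ν t k ≠ μ j := fun t k =>
    ne_pole_of_secular_eq_zero hμinj hα (hsec t k)
  have heq : ∀ t k, t + ∑ j, α j / (ν t k - μ j) = ν t k := fun t k =>
    add_sum_div_of_secular_eq_zero (hne t k) (hsec t k)
  have hcont : ∀ k, Continuous fun t => ν t k := by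
    refine continuous_ordered_roots (g := fun t x => (x - t) * ∏ j, (x - μ j)
      - ∑ i, α i * ∏ j ∈ Finset.univ.erase i, (x - μ j)) (fun x => by fun_prop) hνanti fun t x => ?_
    rw [← eval_secular, secular_eq_prod t (hνanti t).injective (hνroot t), eval_prod]
    simp
  have hopen : IsOpen {x : ℝ | u < (x : EReal) ∧ (x : EReal) < v} :=
    isOpen_Ioo.preimage continuous_coe_real_ereal
  have hord : Set.OrdConnected {x : ℝ | u < (x : EReal) ∧ (x : EReal) < v} :=
    ⟨fun x hx y hy z hz => ⟨hx.1.trans_le (EReal.coe_le_coe_iff.2 hz.1),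
      (EReal.coe_le_coe_iff.2 hz.2).trans_lt hy.2⟩⟩
  refine ExpConvexOn.intro (continuousOn_finsetSum _ fun k _ =>
    hf.1.comp (hcont k).continuousOn fun t ht => hν t ht.1 ht.2 k) fun N t ht x => ?_
  have hsum : ∀ φ : ℝ → ℝ, ∑ i : Fin N × Fin N × Fin (n + 1),
      x i.1 * x i.2.1 * φ (ν (t i.1 + t i.2.1) i.2.2)
      = ∑ r, ∑ s, (∑ k, φ (ν (t r + t s) k)) * x r * x s := fun φ => by
    simp only [Fintype.sum_prod_type, ← Finset.mul_sum]
    exact Finset.sum_congr rfl fun r _ => Finset.sum_congr rfl fun s _ => by ring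
  rw [← hsum f]
  refine hf.sum_nonneg hopen hord (fun i : Fin N × Fin N × Fin (n + 1) => x i.1 * x i.2.1)
    (fun i => ν (t i.1 + t i.2.1) i.2.2)
    (fun i => hν _ (ht i.1 i.2.1).1 (ht i.1 i.2.1).2 i.2.2) fun l => ?_
  rw [hsum fun y => Real.exp (l * y)]
  exact sum_mul_mul_sum_exp_nonneg μ α (fun k => (hα k).le) ν
    (fun t => (hνanti t).injective) hne heq l t x
end

section
/- Let (f_m)_{m≥1} be a sequence of functions, each exponentially convex on (a,b), and suppose that for each t ∈ (a,b) the limit f(t) = lim_{m→∞} f_m(t) exists and is finite. Then f is exponentially convex on (a,b); in particular f is continuous on (a,b). -/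
open ComplexOrder Filter

/-- A continuous midpoint-convex function on `[0, 1]` that vanishes at the endpoints is
nonpositive. -/
theorem nonpos_of_midpoint_le {φ : ℝ → ℝ} (hφ : ContinuousOn φ (Set.Icc 0 1))
    (h0 : φ 0 = 0) (h1 : φ 1 = 0)
    (hmid : ∀ u ∈ Set.Icc (0 : ℝ) 1, ∀ v ∈ Set.Icc (0 : ℝ) 1, 2 * φ ((u + v) / 2) ≤ φ u + φ v)
    {x : ℝ} (hx : x ∈ Set.Icc (0 : ℝ) 1) : φ x ≤ 0 := by
  obtain ⟨z, hz, hzmax⟩ := isCompact_Icc.exists_isMaxOn ⟨x, hx⟩ hφ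
  by_contra! hpos
  have hzpos : 0 < φ z := hpos.trans_le (hzmax hx)
  have hK : IsCompact (Set.Icc (0 : ℝ) 1 ∩ φ ⁻¹' Set.Ici (φ z)) :=
    isCompact_Icc.of_isClosed_subset
      (hφ.preimage_isClosed_of_isClosed isClosed_Icc isClosed_Ici) Set.inter_subset_left
  obtain ⟨c, ⟨⟨hc0, hc1⟩, hcz⟩, hcmin⟩ := hK.exists_isLeast ⟨z, hz, le_refl (φ z)⟩
  have hcz' : φ z ≤ φ c := hcz
  have hc0' : 0 < c := lt_of_le_of_ne hc0 (by rintro rfl; linarith)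
  have hc1' : c < 1 := lt_of_le_of_ne hc1 (by rintro rfl; linarith)
  obtain ⟨d, hd, hdc, hdc1⟩ : ∃ d > 0, d ≤ c ∧ d ≤ 1 - c :=
    ⟨min c (1 - c), lt_min hc0' (by linarith), min_le_left _ _, min_le_right _ _⟩
  have hu : c - d ∈ Set.Icc (0 : ℝ) 1 := ⟨by linarith, by linarith⟩
  have hv : c + d ∈ Set.Icc (0 : ℝ) 1 := ⟨by linarith, by linarith⟩
  have hlt : φ (c - d) < φ z := by
    by_contra! hge
    have : c ≤ c - d := hcmin ⟨hu, hge⟩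
    linarith
  have hle : φ (c + d) ≤ φ z := hzmax hv
  have hcd := hmid _ hu _ hv
  rw [show (c - d + (c + d)) / 2 = c by ring] at hcd
  linarith

/-- A continuous midpoint-convex function on a convex set of reals is convex. -/
theorem convexOn_of_continuousOn_of_midpoint_le {S : Set ℝ} {f : ℝ → ℝ} (hS : Convex ℝ S)
    (hf : ContinuousOn f S)
    (hmid : ∀ x ∈ S, ∀ y ∈ S, 2 * f ((x + y) / 2) ≤ f x + f y) : ConvexOn ℝ S f := by
  refine ⟨hS, fun x hx y hy α β hα hβ hαβ => ?_⟩
  have hmem : ∀ u ∈ Set.Icc (0 : ℝ) 1, (1 - u) * x + u * y ∈ S := fun u hu =>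
    hS hx hy (by linarith [hu.2]) hu.1 (by ring)
  have key := nonpos_of_midpoint_le
    (φ := fun u => f ((1 - u) * x + u * y) - ((1 - u) * f x + u * f y)) (x := β)
    ((hf.comp (by fun_prop) hmem).sub (by fun_prop)) (by simp) (by simp)
    (fun u hu v hv => by
      have h := hmid _ (hmem u hu) _ (hmem v hv)
      rw [show ((1 - u) * x + u * y + ((1 - v) * x + v * y)) / 2
        = (1 - (u + v) / 2) * x + (u + v) / 2 * y by ring] at h
      linarith)
    ⟨hβ, by linarith⟩
  obtain rfl : α = 1 - β := by linarith
  simpa using key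

theorem ExpConvexOn.convexOn {f : ℝ → ℝ} {S : Set ℝ} (hS : Convex ℝ S) (hf : ExpConvexOn f S) :
    ConvexOn ℝ S f := by
  refine convexOn_of_continuousOn_of_midpoint_le hS hf.1 fun x hx y hy => ?_
  have hxy : (x + y) / 2 ∈ S := by
    have := hS hx hy (a := 1 / 2) (b := 1 / 2) (by norm_num) (by norm_num) (by norm_num)
    convert this using 1
    simp only [smul_eq_mul]
    ring
  have exx : x / 2 + x / 2 = x := by ring
  have eyy : y / 2 + y / 2 = y := by ring
  have exy : x / 2 + y / 2 = (x + y) / 2 := by ring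
  have eyx : y / 2 + x / 2 = (x + y) / 2 := by ring
  have h := hf.2 2 ![x / 2, y / 2]
    (by simp [Fin.forall_fin_two, exx, eyy, exy, eyx, hx, hy, hxy]) ![1, -1]
  simp only [Fin.sum_univ_two, Matrix.cons_val_zero, Matrix.cons_val_one, exx, eyy, exy, eyx,
    map_one, map_neg] at h
  have h' := (Complex.le_def.1 h).1
  simp at h'
  linarith

/-- A pointwise limit of convex functions is convex. -/
theorem convexOn_of_tendsto {S : Set ℝ} {F : ℕ → ℝ → ℝ} {f : ℝ → ℝ}
    (hF : ∀ m, ConvexOn ℝ S (F m))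
    (hlim : ∀ t ∈ S, Tendsto (fun m => F m t) atTop (nhds (f t))) : ConvexOn ℝ S f := by
  refine ⟨(hF 0).1, fun x hx y hy α β hα hβ hαβ => ?_⟩
  exact le_of_tendsto_of_tendsto' (hlim _ ((hF 0).1 hx hy hα hβ hαβ))
    (((hlim x hx).const_smul α).add ((hlim y hy).const_smul β))
    fun m => (hF m).2 hx hy hα hβ hαβ

theorem stmt_12 (a b : EReal) (hab : a < b) (fseq : ℕ → ℝ → ℝ) (f : ℝ → ℝ)
    (hseq : ∀ m : ℕ, ExpConvexOn (fseq m)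
      {x : ℝ | a < (x : EReal) ∧ (x : EReal) < b})
    (hlim : ∀ t : ℝ, a < (t : EReal) → (t : EReal) < b →
      Tendsto (fun m => fseq m t) atTop (nhds (f t))) :
    ExpConvexOn f {x : ℝ | a < (x : EReal) ∧ (x : EReal) < b} ∧
    ContinuousOn f {x : ℝ | a < (x : EReal) ∧ (x : EReal) < b} := by
  set S : Set ℝ := {x : ℝ | a < (x : EReal) ∧ (x : EReal) < b} with hSdef
  have hS : Convex ℝ S := by
    refine Set.OrdConnected.convex ⟨fun x hx y hy z hz => ⟨?_, ?_⟩⟩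
    · exact hx.1.trans_le (EReal.coe_le_coe_iff.2 hz.1)
    · exact (EReal.coe_le_coe_iff.2 hz.2).trans_lt hy.2
  have hSo : IsOpen S := isOpen_Ioo.preimage continuous_coe_real_ereal
  have hcont : ContinuousOn f S :=
    (convexOn_of_tendsto (fun m => (hseq m).convexOn hS)
      fun t ht => hlim t ht.1 ht.2).continuousOn hSo
  refine ⟨⟨hcont, fun N t ht ζ => ?_⟩, hcont⟩
  refine ge_of_tendsto' (x := atTop) (tendsto_finsetSum _ fun r _ => tendsto_finsetSum _ fun s _ =>
    Tendsto.mul_const _ (Tendsto.mul_const _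
      ((Complex.continuous_ofReal.tendsto _).comp (hlim _ (ht r s).1 (ht r s).2))))
    fun m => (hseq m).2 N t ht ζ
end

section
/- (Bernstein–Widder representation theorem) A function f on an interval (a,b) admits a representation f(x) = ∫_{ℝ} e^{ξx} σ(dξ) for all x ∈ (a,b), where σ is a nonnegative Borel measure on ℝ for which the integral converges for each x ∈ (a,b), if and only if f is exponentially convex on (a,b). -/
open ComplexOrder MeasureTheory

section Polynomial

open Polynomial

/-- The cone generated by the squares `q ^ 2` and the products `X * q ^ 2` of degree at most `n`. -/
inductive HalfLineSOS (n : ℕ) : ℝ[X] → Prop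
  | sq (q : ℝ[X]) : 2 * q.natDegree ≤ n → HalfLineSOS n (q ^ 2)
  | X_mul_sq (q : ℝ[X]) : 2 * q.natDegree + 1 ≤ n → HalfLineSOS n (X * q ^ 2)
  | add {p q : ℝ[X]} : HalfLineSOS n p → HalfLineSOS n q → HalfLineSOS n (p + q)

theorem HalfLineSOS.mul {m n : ℕ} {p q : ℝ[X]} (hp : HalfLineSOS m p) (hq : HalfLineSOS n q) :
    HalfLineSOS (m + n) (p * q) := by
  induction hp with
  | add _ _ h h' =>
    rw [add_mul]
    exact .add h h'
  | sq r hr =>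
    induction hq with
    | add _ _ h h' =>
      rw [mul_add]
      exact .add h h'
    | sq s hs =>
      rw [← mul_pow]
      have := natDegree_mul_le (p := r) (q := s)
      exact .sq _ (by lia)
    | X_mul_sq s hs =>
      rw [show r ^ 2 * (X * s ^ 2) = X * (r * s) ^ 2 by ring]
      have := natDegree_mul_le (p := r) (q := s)
      exact .X_mul_sq _ (by lia)
  | X_mul_sq r hr =>
    induction hq with
    | add _ _ h h' =>
      rw [mul_add]
      exact .add h h'
    | sq s hs =>
      rw [show X * r ^ 2 * s ^ 2 = X * (r * s) ^ 2 by ring]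
      have := natDegree_mul_le (p := r) (q := s)
      exact .X_mul_sq _ (by lia)
    | X_mul_sq s hs =>
      rw [show X * r ^ 2 * (X * s ^ 2) = (X * (r * s)) ^ 2 by ring]
      have := natDegree_mul_le (p := r) (q := s)
      have := natDegree_mul_le (p := X) (q := r * s)
      have := natDegree_X_le (R := ℝ)
      exact .sq _ (by lia)

theorem HalfLineSOS.C {c : ℝ} (n : ℕ) (hc : 0 ≤ c) : HalfLineSOS n (Polynomial.C c) := by
  rw [← Real.sq_sqrt hc, map_pow]
  exact .sq _ (by simp)

theorem HalfLineSOS.X_add_C {c : ℝ} (hc : 0 ≤ c) : HalfLineSOS 1 (X + Polynomial.C c) := by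
  refine .add ?_ (.C _ hc)
  simpa using HalfLineSOS.X_mul_sq (n := 1) 1 (by simp)

theorem HalfLineSOS.sq_X_sub_C (c : ℝ) : HalfLineSOS 2 ((X - Polynomial.C c) ^ 2) :=
  .sq _ (by simp)

theorem eval_nonneg_of_eventually_nhdsWithin {p : ℝ[X]} {x : ℝ} {s : Set ℝ}
    [(nhdsWithin x s).NeBot] (h : ∀ᶠ y in nhdsWithin x s, 0 ≤ p.eval y) : 0 ≤ p.eval x :=
  ge_of_tendsto ((p.continuous.tendsto x).mono_left nhdsWithin_le_nhds) h

/-- A real polynomial which is nonnegative on the half-line is a sum of terms `q ^ 2` and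
`X * q ^ 2` of no larger degree. -/
theorem HalfLineSOS.of_nonneg {p : ℝ[X]} (hp : ∀ x, 0 < x → 0 ≤ p.eval x) :
    HalfLineSOS p.natDegree p := by
  induction hn : p.natDegree using Nat.strong_induction_on generalizing p with
  | _ n ih =>
  subst hn
  rcases Nat.eq_zero_or_pos p.natDegree with h0 | h0
  · rw [eq_C_of_natDegree_eq_zero h0] at hp ⊢
    exact .C _ (by simpa using hp 1 one_pos)
  have hp0 : p ≠ 0 := by rintro rfl; simp at h0
  obtain ⟨z, hz⟩ := IsAlgClosed.exists_aeval_eq_zero ℂ p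
    (natDegree_pos_iff_degree_pos.mp h0).ne'
  by_cases him : z.im = 0
  · obtain ⟨α, rfl⟩ : ∃ α : ℝ, z = α := ⟨z.re, by apply Complex.ext <;> simp [him]⟩
    have hroot : p.IsRoot α := by
      have : ((p.eval α : ℝ) : ℂ) = 0 := by
        rw [← hz]
        exact (aeval_algebraMap_apply_eq_algebraMap_eval (A := ℂ) α p).symm
      exact_mod_cast this
    obtain ⟨r, rfl⟩ := dvd_iff_isRoot.mpr hroot
    have hr0 : r ≠ 0 := right_ne_zero_of_mul hp0
    have hdeg : ((X - Polynomial.C α) * r).natDegree = 1 + r.natDegree := by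
      rw [natDegree_mul (X_sub_C_ne_zero α) hr0, natDegree_X_sub_C]
    simp only [eval_mul, eval_sub, eval_X, eval_C] at hp
    rcases le_or_gt α 0 with hα | hα
    · rw [hdeg]
      refine .mul ?_ (ih r.natDegree (by lia) (fun x hx => ?_) rfl)
      · rw [sub_eq_add_neg, ← map_neg]
        exact .X_add_C (by linarith)
      · exact nonneg_of_mul_nonneg_right (hp x hx) (by linarith)
    · have hrα : r.IsRoot α := by
        apply le_antisymm
        · have : 0 ≤ (-r).eval α := by
            apply eval_nonneg_of_eventually_nhdsWithin (s := Set.Iio α)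
            filter_upwards [self_mem_nhdsWithin,
              mem_nhdsWithin_of_mem_nhds (lt_mem_nhds hα)] with x (hx : x < α) hx0
            have := hp x hx0
            rw [eval_neg]
            nlinarith
          simpa using this
        · apply eval_nonneg_of_eventually_nhdsWithin (s := Set.Ioi α)
          filter_upwards [self_mem_nhdsWithin] with x (hx : α < x)
          exact nonneg_of_mul_nonneg_right (hp x (hα.trans hx)) (by linarith)
      obtain ⟨s, rfl⟩ := dvd_iff_isRoot.mpr hrα
      have hs0 : s ≠ 0 := right_ne_zero_of_mul hr0
      have hdeg' : ((X - Polynomial.C α) * s).natDegree = 1 + s.natDegree := by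
        rw [natDegree_mul (X_sub_C_ne_zero α) hs0, natDegree_X_sub_C]
      have hpos : ∀ x, 0 < x → x ≠ α → 0 ≤ s.eval x := fun x hx hxα => by
        have := hp x hx
        simp only [eval_mul, eval_sub, eval_X, eval_C, ← mul_assoc] at this
        exact nonneg_of_mul_nonneg_right this (mul_self_pos.mpr (sub_ne_zero.mpr hxα))
      rw [hdeg, hdeg', ← mul_assoc, ← pow_two, ← add_assoc]
      refine .mul (.sq_X_sub_C α) (ih s.natDegree (by lia) (fun x hx => ?_) rfl)
      rcases eq_or_ne x α with rfl | hxα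
      · apply eval_nonneg_of_eventually_nhdsWithin (s := {x}ᶜ)
        filter_upwards [self_mem_nhdsWithin, mem_nhdsWithin_of_mem_nhds (lt_mem_nhds hα)]
          with y hy hy0
        exact hpos y hy0 hy
      · exact hpos x hx hxα
  · obtain ⟨r, hr⟩ := p.quadratic_dvd_of_aeval_eq_zero_im_ne_zero hz him
    set Q : ℝ[X] := X ^ 2 - Polynomial.C (2 * z.re) * X + Polynomial.C (‖z‖ ^ 2) with hQ
    have hQ' : Q = (X - Polynomial.C z.re) ^ 2 + Polynomial.C (z.im ^ 2) := by
      rw [hQ, Complex.sq_norm, Complex.normSq_apply]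
      simp only [map_mul, map_add, map_pow, map_ofNat]
      ring
    have hQpos : ∀ x, 0 < Q.eval x := fun x => by
      rw [hQ']
      simp only [eval_add, eval_pow, eval_sub, eval_X, eval_C]
      positivity
    have hQdeg : Q.natDegree = 2 := by rw [hQ]; compute_degree!
    have hr0 : r ≠ 0 := by rintro rfl; simp [hr] at hp0
    have hQ0 : Q ≠ 0 := by intro h; simp [h] at hQdeg
    have hdeg : p.natDegree = 2 + r.natDegree := by rw [hr, natDegree_mul hQ0 hr0, hQdeg]
    rw [hdeg, hr]
    refine .mul ?_ (ih r.natDegree (by lia) (fun x hx => ?_) rfl)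
    · rw [hQ']
      exact .add (.sq_X_sub_C _) (.C _ (sq_nonneg _))
    · have := hp x hx
      rw [hr, eval_mul] at this
      exact nonneg_of_mul_nonneg_right this (hQpos x)

end Polynomial

section MomentProblem

open CompactlySupported Filter

/-- Solvability of a generalized moment problem on the line: a positive linear functional on the
span of positive continuous functions `e i`, none of which is of maximal growth at infinity, is
given by integration against a measure. -/
theorem exists_measure_integral_eq_of_positive {ι : Type*} [Nonempty ι] (e : ι → C(ℝ, ℝ))
    (c : ι → ℝ) (he : ∀ i x, 0 < e i x)
    (hc : ∀ p : ι →₀ ℝ, (∀ x, 0 ≤ p.sum fun i r => r * e i x) → 0 ≤ p.sum fun i r => r * c i)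
    (hdom : ∀ i, ∃ j k, ∀ ε > 0, ∀ᶠ x in cocompact ℝ, e i x ≤ ε * (e j x + e k x)) :
    ∃ σ : Measure ℝ, ∀ i, Integrable (e i) σ ∧ ∫ x, e i x ∂σ = c i := by
  classical
  let ev (x : ℝ) : (ι →₀ ℝ) →ₗ[ℝ] ℝ := Finsupp.lsum ℝ fun i => LinearMap.mulRight ℝ (e i x)
  let L : (ι →₀ ℝ) →ₗ[ℝ] ℝ := Finsupp.lsum ℝ fun i => LinearMap.mulRight ℝ (c i)
  have ev_single (x : ℝ) (i : ι) (r : ℝ) : ev x (.single i r) = r * e i x := by simp [ev]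
  have L_single (i : ι) (r : ℝ) : L (.single i r) = r * c i := by simp [L]
  let s : PointedCone ℝ ((ι →₀ ℝ) × C_c(ℝ, ℝ)) :=
    { carrier := {y | ∀ x, 0 ≤ ev x y.1 + y.2 x}
      add_mem' := fun {y z} hy hz x => by
        have := add_nonneg (hy x) (hz x)
        simp only [Prod.fst_add, Prod.snd_add, map_add, CompactlySupportedContinuousMap.coe_add,
          Pi.add_apply]
        linarith
      zero_mem' := fun x => by simp
      smul_mem' := fun r y hy x => by
        have := mul_nonneg r.2 (hy x)
        have hr : r • y = (r : ℝ) • y := rfl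
        simp only [hr, Prod.smul_fst, Prod.smul_snd, map_smul, smul_eq_mul,
          CompactlySupportedContinuousMap.coe_smul, Pi.smul_apply]
        linarith }
  let F : ((ι →₀ ℝ) × C_c(ℝ, ℝ)) →ₗ.[ℝ] ℝ :=
    { domain := Submodule.prod ⊤ ⊥
      toFun := L ∘ₗ LinearMap.fst ℝ _ _ ∘ₗ Submodule.subtype _ }
  obtain ⟨G, hGF, hGs⟩ := riesz_extension s F
    (by
      rintro ⟨⟨p, g⟩, hg⟩ hp
      obtain rfl : g = 0 := by simpa [F] using hg
      exact hc p fun x => by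
        simpa only [CompactlySupportedContinuousMap.coe_zero, Pi.zero_apply, add_zero] using! hp x)
    (by
      rintro ⟨p, g⟩
      obtain ⟨i⟩ := ‹Nonempty ι›
      have hcont : Continuous fun x => g x * (e i x)⁻¹ :=
        g.continuous.mul ((e i).continuous.inv₀ fun x => (he i x).ne')
      obtain ⟨M, hM⟩ := (g.hasCompactSupport.mul_right
        (f' := fun x => (e i x)⁻¹)).exists_bound_of_continuous hcont
      refine ⟨⟨(.single i M - p, 0), by simp [F]⟩, fun x => ?_⟩
      have h1 : -M ≤ g x * (e i x)⁻¹ := neg_le_of_abs_le (hM x)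
      have h2 : -M * e i x ≤ g x := by
        have := mul_le_mul_of_nonneg_right h1 (he i x).le
        rwa [mul_assoc, inv_mul_cancel₀ (he i x).ne', mul_one] at this
      simp only [Prod.mk_add_mk, sub_add_cancel, zero_add, ev_single]
      linarith)
  have hGL (p : ι →₀ ℝ) : G (p, 0) = L p := hGF ⟨(p, 0), by simp [F]⟩
  let Λ : C_c(ℝ, ℝ) →ₚ[ℝ] ℝ := PositiveLinearMap.mk₀ (G ∘ₗ LinearMap.inr ℝ _ _) fun g hg =>
    hGs _ fun x => by simpa using hg x
  have hΛ (p : ι →₀ ℝ) (g : C_c(ℝ, ℝ)) : G (p, g) = L p + Λ g := by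
    rw [← hGL, show Λ g = G (0, g) from rfl, ← map_add]
    simp
  let σ := RealRMK.rieszMeasure Λ
  have hσ (g : C_c(ℝ, ℝ)) : ∫ x, g x ∂σ = Λ g := RealRMK.integral_rieszMeasure Λ g
  have cutoff (i : ι) {K : Set ℝ} (hK : IsCompact K) : ∃ g : C_c(ℝ, ℝ),
      (∀ x, 0 ≤ g x) ∧ (∀ x, g x ≤ e i x) ∧ ∀ x ∈ K, g x = e i x := by
    obtain ⟨χ, hχ1, -, hχc, hχ⟩ :=
      exists_continuous_one_zero_of_isCompact hK isClosed_empty (Set.disjoint_empty K)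
    refine ⟨⟨χ * e i, hχc.mul_right⟩, fun x => mul_nonneg (hχ x).1 (he i x).le,
      fun x => mul_le_of_le_one_left (he i x).le (hχ x).2, fun x hx => ?_⟩
    change χ x * e i x = e i x
    rw [hχ1 hx, Pi.one_apply, one_mul]
  have gint (g : C_c(ℝ, ℝ)) : Integrable g σ :=
    g.continuous.integrable_of_hasCompactSupport g.hasCompactSupport
  have hle (i : ι) (g : C_c(ℝ, ℝ)) (hg : ∀ x, g x ≤ e i x) : Λ g ≤ c i := by
    have := hGs (.single i 1, -g) fun x => by
      simpa [ev_single] using hg x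
    rw [hΛ, map_neg, L_single] at this
    linarith
  have hball (i : ι) (n : ℕ) : ∫ x in Metric.closedBall (0 : ℝ) n, e i x ∂σ ≤ c i := by
    obtain ⟨g, hg0, hgle, hgK⟩ := cutoff i (isCompact_closedBall (0 : ℝ) n)
    calc ∫ x in Metric.closedBall (0 : ℝ) n, e i x ∂σ
        = ∫ x in Metric.closedBall (0 : ℝ) n, g x ∂σ :=
          setIntegral_congr_fun Metric.isClosed_closedBall.measurableSet fun x hx => (hgK x hx).symm
      _ ≤ ∫ x, g x ∂σ := setIntegral_le_integral (gint g) (ae_of_all _ hg0)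
      _ = Λ g := hσ g
      _ ≤ c i := hle i g hgle
  have hcover : AECover σ atTop fun n : ℕ => Metric.closedBall (0 : ℝ) n :=
    aecover_closedBall tendsto_natCast_atTop_atTop
  have hInt (i : ι) : Integrable (e i) σ :=
    hcover.integrable_of_integral_bounded_of_nonneg_ae (c i)
      (fun n => (e i).continuous.continuousOn.integrableOn_compact (isCompact_closedBall _ _))
      (ae_of_all _ fun x => (he i x).le) (Eventually.of_forall (hball i))
  refine ⟨σ, fun i => ⟨hInt i, le_antisymm ?_ ?_⟩⟩
  · exact le_of_tendsto (hcover.integral_tendsto_of_countably_generated (hInt i))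
      (Eventually.of_forall (hball i))
  · obtain ⟨j, k, hjk⟩ := hdom i
    have key (ε : ℝ) (hε : 0 < ε) : c i ≤ ∫ x, e i x ∂σ + ε * (c j + c k) := by
      obtain ⟨K, hK, hKe⟩ := mem_cocompact.mp (hjk ε hε)
      obtain ⟨g, hg0, hgle, hgK⟩ := cutoff i hK
      have h := hGs (.single j ε + .single k ε - .single i 1, g) fun x => by
        simp only [map_add, map_sub, ev_single]
        by_cases hx : x ∈ K
        · rw [hgK x hx]
          nlinarith [he j x, he k x]
        · have : e i x ≤ ε * (e j x + e k x) := hKe hx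
          linarith [hg0 x]
      rw [hΛ, map_sub, map_add, L_single, L_single, L_single, ← hσ] at h
      have := integral_mono (gint g) (hInt i) hgle
      linarith
    have ht : Tendsto (fun ε : ℝ => ∫ x, e i x ∂σ + ε * (c j + c k)) (nhdsWithin 0 (Set.Ioi 0))
        (nhds (∫ x, e i x ∂σ + 0 * (c j + c k))) :=
      (Continuous.tendsto (by fun_prop) 0).mono_left nhdsWithin_le_nhds
    rw [zero_mul, add_zero] at ht
    exact ge_of_tendsto ht (eventually_mem_nhdsWithin.mono key)

end MomentProblem

section ExponentiallyConvex

open Polynomial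

/-- The linear functional on polynomials sending `X ^ k` to `f (d + k * h)`. -/
noncomputable def progressionFunctional (f : ℝ → ℝ) (d h : ℝ) : ℝ[X] →ₗ[ℝ] ℝ :=
  Polynomial.lsum fun k => LinearMap.mulRight ℝ (f (d + k * h))

theorem progressionFunctional_monomial (f : ℝ → ℝ) (d h : ℝ) (k : ℕ) (r : ℝ) :
    progressionFunctional f d h (monomial k r) = r * f (d + k * h) := by
  simp [progressionFunctional, Polynomial.lsum_apply]

theorem progressionFunctional_X_mul (f : ℝ → ℝ) (d h : ℝ) (p : ℝ[X]) :
    progressionFunctional f d h (X * p) = progressionFunctional f (d + h) h p := by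
  induction p using Polynomial.induction_on' with
  | add p q hp hq => rw [mul_add, map_add, map_add, hp, hq]
  | monomial k r =>
    rw [X_mul_monomial, progressionFunctional_monomial, progressionFunctional_monomial]
    push_cast
    ring_nf

theorem ExpConvexOn.sum_real_nonneg {f : ℝ → ℝ} {S : Set ℝ} (hf : ExpConvexOn f S) {N : ℕ}
    {t : Fin N → ℝ} (ht : ∀ r s, t r + t s ∈ S) (z : Fin N → ℝ) :
    0 ≤ ∑ r, ∑ s, f (t r + t s) * z r * z s := by
  have := hf.2 N t ht fun r => z r
  simp only [Complex.conj_ofReal] at this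
  exact_mod_cast this

theorem ExpConvexOn.progressionFunctional_sq_nonneg {f : ℝ → ℝ} {S : Set ℝ}
    (hf : ExpConvexOn f S) {d h : ℝ} {q : ℝ[X]}
    (hS : ∀ k : ℕ, k ≤ 2 * q.natDegree → d + k * h ∈ S) :
    0 ≤ progressionFunctional f d h (q ^ 2) := by
  have hsplit (i j : ℕ) : d / 2 + i * h + (d / 2 + j * h) = d + (i + j : ℕ) * h := by
    push_cast
    ring
  have key := hf.sum_real_nonneg (N := q.natDegree + 1) (t := fun i => d / 2 + i * h)
    (fun i j => by rw [hsplit]; exact hS _ (by lia)) fun i => q.coeff i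
  refine key.trans_eq (Eq.symm ?_)
  conv_lhs => rw [pow_two, q.as_sum_range' _ (Nat.lt_succ_self _), Finset.sum_mul_sum]
  simp only [map_sum, monomial_mul_monomial, progressionFunctional_monomial, Finset.sum_range,
    hsplit]
  refine Finset.sum_congr rfl fun i _ => Finset.sum_congr rfl fun j _ => ?_
  ring

theorem ExpConvexOn.progressionFunctional_nonneg {f : ℝ → ℝ} {S : Set ℝ} (hf : ExpConvexOn f S)
    {d h : ℝ} {n : ℕ} {p : ℝ[X]} (hp : HalfLineSOS n p) (hS : ∀ k : ℕ, k ≤ n → d + k * h ∈ S) :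
    0 ≤ progressionFunctional f d h p := by
  induction hp with
  | sq q hq => exact hf.progressionFunctional_sq_nonneg fun k hk => hS k (by lia)
  | X_mul_sq q hq =>
    rw [progressionFunctional_X_mul]
    refine hf.progressionFunctional_sq_nonneg fun k hk => ?_
    have := hS (k + 1) (by lia)
    push_cast at this
    convert this using 1
    ring
  | add _ _ hp hq =>
    rw [map_add]
    exact add_nonneg hp hq

theorem exists_eq_add_nat_mul_of_finset {A : Finset ℚ} {q₀ : ℚ} (hq₀ : ∀ q ∈ A, q₀ ≤ q) :
    ∃ h : ℝ, 0 < h ∧ ∃ k : ℚ → ℕ, ∀ q ∈ A, (q : ℝ) = q₀ + k q * h := by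
  set D : ℕ := q₀.den * ∏ q ∈ A, q.den with hD
  have hDpos : 0 < D := Nat.mul_pos q₀.pos (Finset.prod_pos fun q _ => q.pos)
  have hInt (q : ℚ) (hq : q.den ∣ D) : ∃ z : ℤ, q * D = z := by
    obtain ⟨m, hm⟩ := hq
    refine ⟨q.num * m, ?_⟩
    rw [hm]
    push_cast
    rw [← mul_assoc, Rat.mul_den_eq_num]
  have hk (q : ℚ) : ∃ k : ℕ, q ∈ A → (q - q₀) * D = k := by
    by_cases hq : q ∈ A
    · obtain ⟨z, hz⟩ := hInt q ((Finset.dvd_prod_of_mem _ hq).mul_left _)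
      obtain ⟨z₀, hz₀⟩ := hInt q₀ (dvd_mul_right _ _)
      have hzz : z₀ ≤ z := by
        have : q₀ * (D : ℚ) ≤ q * D := mul_le_mul_of_nonneg_right (hq₀ q hq) (by positivity)
        rw [hz, hz₀] at this
        exact_mod_cast this
      refine ⟨(z - z₀).toNat, fun _ => ?_⟩
      rw [sub_mul, hz, hz₀, ← Int.cast_natCast, Int.toNat_of_nonneg (sub_nonneg.mpr hzz)]
      push_cast
      rfl
    · exact ⟨0, fun h => absurd h hq⟩
  choose k hk using hk
  refine ⟨(D : ℝ)⁻¹, by positivity, k, fun q hq => ?_⟩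
  have : ((q : ℝ) - q₀) * D = k q := by exact_mod_cast hk q hq
  rw [← this]
  field_simp
  ring

/-- A nonnegative exponential polynomial with rational exponents stays nonnegative after replacing
`exp (x * q)` by `f q`, for an exponentially convex function `f`. -/
theorem ExpConvexOn.finsupp_sum_nonneg {f : ℝ → ℝ} {S : Set ℝ} (hf : ExpConvexOn f S)
    (hS : S.OrdConnected) (p : {q : ℚ // (q : ℝ) ∈ S} →₀ ℝ)
    (hp : ∀ x : ℝ, 0 ≤ p.sum fun q r => r * Real.exp (x * (q : ℚ))) :
    0 ≤ p.sum fun q r => r * f (q : ℚ) := by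
  classical
  rcases eq_or_ne p 0 with rfl | hp0
  · simp
  have hne : p.support.Nonempty := Finsupp.support_nonempty_iff.mpr hp0
  obtain ⟨q₀, hq₀, hmin⟩ := p.support.exists_min_image id hne
  obtain ⟨q₁, hq₁, hmax⟩ := p.support.exists_max_image id hne
  obtain ⟨h, hh, k, hk'⟩ := exists_eq_add_nat_mul_of_finset
    (A := p.support.image Subtype.val) (q₀ := q₀) (by
      simp only [Finset.forall_mem_image]
      exact fun q hq => hmin q hq)
  simp only [Finset.forall_mem_image] at hk'
  have hk (q) (hq : q ∈ p.support) : ((q : ℚ) : ℝ) = (q₀ : ℚ) + k q * h := hk' hq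
  set P : ℝ[X] := p.sum fun q r => monomial (k q) r with hP
  have hdeg : P.natDegree ≤ k q₁ := by
    refine natDegree_sum_le_of_forall_le _ _ fun q hq => (natDegree_monomial_le _).trans ?_
    have : ((q : ℚ) : ℝ) ≤ (q₁ : ℚ) := by exact_mod_cast hmax q hq
    rw [hk q hq, hk q₁ hq₁] at this
    have := le_of_mul_le_mul_right (le_of_add_le_add_left this) hh
    exact_mod_cast this
  have hPnonneg (x : ℝ) (hx : 0 < x) : 0 ≤ P.eval x := by
    set y := Real.log x / h with hy
    have hxy : x = Real.exp (y * h) := by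
      rw [hy, div_mul_cancel₀ _ hh.ne', Real.exp_log hx]
    refine nonneg_of_mul_nonneg_right ?_ (Real.exp_pos (y * (q₀ : ℚ)))
    refine (hp y).trans_eq (Eq.symm ?_)
    rw [hP, Finsupp.sum, Finsupp.sum, eval_finsetSum, Finset.mul_sum]
    refine Finset.sum_congr rfl fun q hq => ?_
    rw [eval_monomial, hxy, ← Real.exp_nat_mul, mul_left_comm, ← Real.exp_add, hk q hq]
    ring_nf
  have key := hf.progressionFunctional_nonneg (d := (q₀ : ℚ)) (h := h)
    (HalfLineSOS.of_nonneg hPnonneg) fun n hn => hS.out q₀.2 q₁.2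
      ⟨le_add_of_nonneg_right (by positivity), by
        rw [hk q₁ hq₁]
        have : (n : ℝ) ≤ k q₁ := by exact_mod_cast hn.trans hdeg
        gcongr⟩
  refine key.trans_eq ?_
  rw [hP, Finsupp.sum, Finsupp.sum, map_sum]
  refine Finset.sum_congr rfl fun q hq => ?_
  rw [progressionFunctional_monomial, ← hk q hq]

end ExponentiallyConvex

section Representation

open ProbabilityTheory Filter

theorem eventually_cocompact_exp_mul_le {j q k ε : ℝ} (hjq : j < q) (hqk : q < k) (hε : 0 < ε) :
    ∀ᶠ x in cocompact ℝ, Real.exp (x * q) ≤ ε * (Real.exp (x * j) + Real.exp (x * k)) := by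
  rw [cocompact_eq_atBot_atTop, eventually_sup]
  have hexp {u : ℝ} {x : ℝ} (hx : ε⁻¹ ≤ Real.exp (x * (u - q))) :
      Real.exp (x * q) ≤ ε * Real.exp (x * u) := by
    rw [show x * u = x * (u - q) + x * q by ring, Real.exp_add, ← mul_assoc]
    exact le_mul_of_one_le_left (Real.exp_pos _).le ((inv_le_iff_one_le_mul₀' hε).mp hx)
  constructor
  · have ht : Tendsto (fun x : ℝ => Real.exp (x * (j - q))) atBot atTop :=
      Real.tendsto_exp_atTop.comp (tendsto_id.atBot_mul_const_of_neg (by linarith))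
    filter_upwards [ht.eventually_ge_atTop ε⁻¹] with x hx
    have := hexp hx
    nlinarith [Real.exp_pos (x * k)]
  · have ht : Tendsto (fun x : ℝ => Real.exp (x * (k - q))) atTop atTop :=
      Real.tendsto_exp_atTop.comp (tendsto_id.atTop_mul_const (by linarith))
    filter_upwards [ht.eventually_ge_atTop ε⁻¹] with x hx
    have := hexp hx
    nlinarith [Real.exp_pos (x * j)]

theorem continuousOn_mgf_of_isOpen {σ : Measure ℝ} {S : Set ℝ} (hS : IsOpen S)
    (h : S ⊆ integrableExpSet id σ) : ContinuousOn (mgf id σ) S := fun _ hx =>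
  (analyticAt_mgf (interior_maximal h hS hx)).continuousAt.continuousWithinAt

theorem mgf_id_eq_integral (σ : Measure ℝ) (x : ℝ) :
    mgf id σ x = ∫ ξ : ℝ, Real.exp (ξ * x) ∂σ := by
  simp only [mgf, id, mul_comm]

theorem mem_integrableExpSet_id_iff {σ : Measure ℝ} {x : ℝ} :
    x ∈ integrableExpSet id σ ↔ Integrable (fun ξ : ℝ => Real.exp (ξ * x)) σ := by
  simp only [integrableExpSet, Set.mem_ofPred_eq, id, mul_comm]

theorem expConvexOn_of_eq_integral {σ : Measure ℝ} {f : ℝ → ℝ} {S : Set ℝ} (hS : IsOpen S)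
    (h : ∀ x ∈ S, Integrable (fun ξ : ℝ => Real.exp (ξ * x)) σ ∧
      f x = ∫ ξ : ℝ, Real.exp (ξ * x) ∂σ) : ExpConvexOn f S := by
  refine ⟨(continuousOn_mgf_of_isOpen hS
    fun x hx => mem_integrableExpSet_id_iff.mpr (h x hx).1).congr fun x hx => ?_, ?_⟩
  · rw [(h x hx).2, mgf_id_eq_integral]
  intro N t ht ζ
  have hInt (r s : Fin N) : Integrable
      (fun ξ : ℝ => (Real.exp (ξ * (t r + t s)) : ℂ) * ζ r * (starRingEnd ℂ) (ζ s)) σ :=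
    (((h _ (ht r s)).1.ofReal).mul_const _).mul_const _
  have hsum : ∑ r, ∑ s, (f (t r + t s) : ℂ) * ζ r * (starRingEnd ℂ) (ζ s) =
      ∫ ξ : ℝ, ((Complex.normSq (∑ r, (Real.exp (ξ * t r) : ℂ) * ζ r) : ℝ) : ℂ) ∂σ := by
    calc _ = ∑ r, ∑ s, ∫ ξ : ℝ,
          (Real.exp (ξ * (t r + t s)) : ℂ) * ζ r * (starRingEnd ℂ) (ζ s) ∂σ := by
          refine Finset.sum_congr rfl fun r _ => Finset.sum_congr rfl fun s _ => ?_
          rw [(h _ (ht r s)).2, integral_mul_const, integral_mul_const, integral_complex_ofReal]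
      _ = ∫ ξ : ℝ, ∑ r, ∑ s,
          (Real.exp (ξ * (t r + t s)) : ℂ) * ζ r * (starRingEnd ℂ) (ζ s) ∂σ := by
          rw [integral_finsetSum _ fun r _ => integrable_finsetSum _ fun s _ => hInt r s]
          exact Finset.sum_congr rfl fun r _ => (integral_finsetSum _ fun s _ => hInt r s).symm
      _ = _ := by
          congr 1 with ξ
          rw [← Complex.mul_conj, map_sum, Finset.sum_mul_sum]
          refine Finset.sum_congr rfl fun r _ => Finset.sum_congr rfl fun s _ => ?_
          rw [map_mul, Complex.conj_ofReal, mul_add, Real.exp_add]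
          push_cast
          ring
  rw [hsum, integral_complex_ofReal]
  exact_mod_cast integral_nonneg fun ξ => Complex.normSq_nonneg _

theorem ExpConvexOn.exists_measure {f : ℝ → ℝ} {S : Set ℝ} (hf : ExpConvexOn f S)
    (hS : IsOpen S) (hS' : S.OrdConnected) (hne : S.Nonempty) :
    ∃ σ : Measure ℝ, ∀ x ∈ S, Integrable (fun ξ : ℝ => Real.exp (ξ * x)) σ ∧
      f x = ∫ ξ : ℝ, Real.exp (ξ * x) ∂σ := by
  have hrat {x : ℝ} (hx : x ∈ S) : (∃ q : ℚ, (q : ℝ) ∈ S ∧ (q : ℝ) < x) ∧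
      ∃ q : ℚ, (q : ℝ) ∈ S ∧ x < (q : ℝ) := by
    obtain ⟨l, u, ⟨hl, hu⟩, hlu⟩ := mem_nhds_iff_exists_Ioo_subset.mp (hS.mem_nhds hx)
    obtain ⟨q, hq⟩ := exists_rat_btwn hl
    obtain ⟨r, hr⟩ := exists_rat_btwn hu
    exact ⟨⟨q, hlu ⟨hq.1, hq.2.trans hu⟩, hq.2⟩, ⟨r, hlu ⟨hl.trans hr.1, hr.2⟩, hr.1⟩⟩
  have : Nonempty {q : ℚ // (q : ℝ) ∈ S} := by
    obtain ⟨x, hx⟩ := hne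
    obtain ⟨q, hq, -⟩ := (hrat hx).1
    exact ⟨q, hq⟩
  obtain ⟨σ, hσ⟩ := exists_measure_integral_eq_of_positive
    (fun q : {q : ℚ // (q : ℝ) ∈ S} => ⟨fun x => Real.exp (x * (q : ℚ)), by fun_prop⟩)
    (fun q => f (q : ℚ)) (fun q x => Real.exp_pos _) (hf.finsupp_sum_nonneg hS') (fun q => by
      obtain ⟨⟨j, hj, hjq⟩, k, hk, hqk⟩ := hrat q.2
      exact ⟨⟨j, hj⟩, ⟨k, hk⟩, fun ε hε => eventually_cocompact_exp_mul_le hjq hqk hε⟩)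
  have hQ (q : ℚ) (hq : (q : ℝ) ∈ S) : (q : ℝ) ∈ integrableExpSet id σ :=
    mem_integrableExpSet_id_iff.mpr (hσ ⟨q, hq⟩).1
  have hsub : S ⊆ integrableExpSet id σ := fun x hx => by
    obtain ⟨⟨j, hj, hjx⟩, k, hk, hxk⟩ := hrat hx
    exact integrable_exp_mul_of_le_of_le (hQ j hj) (hQ k hk) hjx.le hxk.le
  have heq : Set.EqOn f (mgf id σ) S := by
    refine Set.EqOn.of_subset_closure (s := S ∩ Set.range ((↑) : ℚ → ℝ)) ?_ hf.1
      (continuousOn_mgf_of_isOpen hS hsub) Set.inter_subset_left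
      (Rat.denseRange_cast.open_subset_closure_inter hS)
    rintro _ ⟨hq, q, rfl⟩
    rw [mgf_id_eq_integral]
    exact (hσ ⟨q, hq⟩).2.symm
  exact ⟨σ, fun x hx => ⟨mem_integrableExpSet_id_iff.mp (hsub hx),
    (heq hx).trans (mgf_id_eq_integral σ x)⟩⟩

end Representation

/-- The Bernstein–Widder representation theorem. -/
theorem stmt_13 (a b : EReal) (hab : a < b) (f : ℝ → ℝ) :
    (∃ σ : Measure ℝ,
      ∀ x : ℝ, a < (x : EReal) → (x : EReal) < b →
        Integrable (fun ξ : ℝ => Real.exp (ξ * x)) σ ∧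
        f x = ∫ ξ : ℝ, Real.exp (ξ * x) ∂σ) ↔
    ExpConvexOn f {x : ℝ | a < (x : EReal) ∧ (x : EReal) < b} := by
  have hopen : IsOpen {x : ℝ | a < (x : EReal) ∧ (x : EReal) < b} :=
    (isOpen_Ioo (a := a) (b := b)).preimage continuous_coe_real_ereal
  constructor
  · rintro ⟨σ, hσ⟩
    exact expConvexOn_of_eq_integral hopen fun x hx => hσ x hx.1 hx.2
  · intro hf
    obtain ⟨x, hx⟩ := EReal.lt_iff_exists_real_btwn.mp hab
    obtain ⟨σ, hσ⟩ := hf.exists_measure hopen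
      ⟨fun x hx y hy z hz => ⟨hx.1.trans_le (EReal.coe_le_coe hz.1),
        (EReal.coe_le_coe hz.2).trans_lt hy.2⟩⟩ ⟨x, hx⟩
    exact ⟨σ, fun x hax hxb => hσ x ⟨hax, hxb⟩⟩
end

section
/- If f is exponentially convex on (a,b), then f extends to a holomorphic function on the strip {z ∈ ℂ : a < Re z < b}; that is, there exists a function F, complex-differentiable on that strip, with F(x) = f(x) for all real x ∈ (a,b). -/
open ComplexOrder

open Polynomial Filter Topology

/-- A real polynomial that is nonnegative off one point is nonnegative there too. -/
theorem Polynomial.eval_nonneg_of_forall_ne {P : ℝ[X]} {a : ℝ} (h : ∀ y, y ≠ a → 0 ≤ P.eval y)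
    (x : ℝ) : 0 ≤ P.eval x := by
  have hclosed : IsClosed {y : ℝ | 0 ≤ P.eval y} := isClosed_le continuous_const P.continuous
  have hdense : Dense ({a}ᶜ : Set ℝ) := dense_compl_singleton a
  have hsub : closure ({a}ᶜ : Set ℝ) ⊆ {y : ℝ | 0 ≤ P.eval y} :=
    closure_minimal (fun y hy => h y hy) hclosed
  exact hsub (hdense x)

/-- A nonnegative real polynomial of positive degree is divisible by the real quadratic attached
to one of its complex roots. -/
theorem Polynomial.exists_quadratic_dvd_of_nonneg {P : ℝ[X]} (hP : ∀ x, 0 ≤ P.eval x)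
    (hdeg : P.natDegree ≠ 0) :
    ∃ z : ℂ, X ^ 2 - C (2 * z.re) * X + C (‖z‖ ^ 2) ∣ P := by
  have hP0 : P ≠ 0 := by rintro rfl; simp at hdeg
  obtain ⟨z, hz⟩ := Complex.exists_root (f := P.map (algebraMap ℝ ℂ)) (by
    rw [degree_map]; exact natDegree_pos_iff_degree_pos.1 (Nat.pos_of_ne_zero hdeg))
  have hz' : aeval z P = 0 := by rwa [IsRoot.def, eval_map_algebraMap] at hz
  refine ⟨z, ?_⟩
  by_cases him : z.im = 0
  · obtain ⟨x, rfl⟩ : ∃ x : ℝ, (x : ℂ) = z := ⟨z.re, by apply Complex.ext <;> simp [him]⟩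
    have hx : P.eval x = 0 := by
      have h := Polynomial.aeval_algebraMap_apply ℂ x P
      rw [Complex.coe_algebraMap, hz'] at h
      simpa using h.symm
    have hd : P.derivative.eval x = 0 := by
      have hmin : IsLocalMin (fun y => P.eval y) x :=
        Eventually.of_forall fun y => by simpa [hx] using hP y
      simpa using hmin.deriv_eq_zero
    have hmul : 1 < P.rootMultiplicity x :=
      (one_lt_rootMultiplicity_iff_isRoot hP0).2 ⟨hx, hd⟩
    have hdvd : (X - C x) ^ 2 ∣ P :=
      (pow_dvd_pow _ hmul).trans (pow_rootMultiplicity_dvd P x)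
    convert hdvd using 1
    simp only [Complex.ofReal_re, Complex.norm_real, Real.norm_eq_abs, sq_abs, C_mul, C_pow,
      map_ofNat]
    ring
  · exact quadratic_dvd_of_aeval_eq_zero_im_ne_zero P hz' him

/-- A nonnegative real polynomial is the squared modulus of a complex polynomial. -/
theorem Polynomial.exists_map_eq_mul_conj_of_nonneg (P : ℝ[X]) (hP : ∀ x, 0 ≤ P.eval x) :
    ∃ Q : ℂ[X], P.map Complex.ofRealHom = Q * Q.map (starRingEnd ℂ) := by
  induction hn : P.natDegree using Nat.strong_induction_on generalizing P with
  | _ n ih =>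
  by_cases hdeg : P.natDegree = 0
  · obtain ⟨c, rfl⟩ := natDegree_eq_zero.1 hdeg
    have hc : 0 ≤ c := by simpa using hP 0
    refine ⟨C (Real.sqrt c : ℂ), ?_⟩
    rw [map_C, map_C, ← C_mul, Complex.conj_ofReal, ← Complex.ofReal_mul, Real.mul_self_sqrt hc]
    rfl
  · obtain ⟨z, S, hS⟩ := exists_quadratic_dvd_of_nonneg hP hdeg
    set D : ℝ[X] := X ^ 2 - C (2 * z.re) * X + C (‖z‖ ^ 2) with hD
    have hDeg : D.natDegree = 2 := by rw [hD]; compute_degree!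
    have hS0 : S ≠ 0 := by rintro rfl; simp [hS] at hdeg
    have hD0 : D ≠ 0 := by intro h; simp [h] at hDeg
    have hSn : ∀ x, 0 ≤ S.eval x := by
      refine eval_nonneg_of_forall_ne (a := z.re) fun y hy => ?_
      have h := hP y
      rw [hS, eval_mul] at h
      refine nonneg_of_mul_nonneg_right h ?_
      have : D.eval y = (y - z.re) ^ 2 + z.im ^ 2 := by
        simp only [hD, eval_add, eval_sub, eval_mul, eval_pow, eval_X, eval_C,
          ← Complex.normSq_eq_norm_sq, Complex.normSq_apply]
        ring
      rw [this]
      have : 0 < (y - z.re) ^ 2 := by have := sub_ne_zero.2 hy; positivity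
      positivity
    have hlt : S.natDegree < n := by
      rw [← hn, hS, natDegree_mul hD0 hS0]; omega
    obtain ⟨Q, hQ⟩ := ih _ hlt S hSn rfl
    refine ⟨(X - C z) * Q, ?_⟩
    have hDz : D.map Complex.ofRealHom = (X - C z) * (X - C (starRingEnd ℂ z)) := by
      have h1 : ((2 * z.re : ℝ) : ℂ) = z + starRingEnd ℂ z := (Complex.add_conj z).symm
      have h1' : (C (2 * z.re)).map Complex.ofRealHom = C z + C (starRingEnd ℂ z) := by
        rw [map_C, Complex.ofRealHom_eq_coe, h1, C_add]
      have h2 : ((‖z‖ ^ 2 : ℝ) : ℂ) = z * starRingEnd ℂ z := by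
        rw [Complex.mul_conj, Complex.normSq_eq_norm_sq]
      rw [hD, Polynomial.map_add, Polynomial.map_sub, Polynomial.map_mul, h1',
        Polynomial.map_pow, map_X, map_C, Complex.ofRealHom_eq_coe, h2, C_mul]
      ring
    rw [hS, Polynomial.map_mul, hDz, hQ]
    simp only [Polynomial.map_mul, Polynomial.map_sub, map_X, map_C]
    ring

/-- Entire functions dominated on vertical lines by their convex restriction to the real line;
nonnegative combinations of real exponentials are the examples that matter. -/
structure ExpDominated (E : ℂ → ℂ) : Prop where
  differentiable : Differentiable ℂ E
  norm_le : ∀ z : ℂ, ‖E z‖ ≤ (E (z.re : ℂ)).re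
  convexOn : ConvexOn ℝ Set.univ fun x : ℝ => (E (x : ℂ)).re

namespace ExpDominated

theorem zero : ExpDominated 0 where
  differentiable := differentiable_const 0
  norm_le := by simp
  convexOn := by simpa using convexOn_const (0 : ℝ) (convex_univ (𝕜 := ℝ) (E := ℝ))

theorem add {E G : ℂ → ℂ} (hE : ExpDominated E) (hG : ExpDominated G) : ExpDominated (E + G) where
  differentiable := hE.differentiable.add hG.differentiable
  norm_le z := (norm_add_le _ _).trans <| by
    simpa using add_le_add (hE.norm_le z) (hG.norm_le z)
  convexOn := by
    have h := hE.convexOn.add hG.convexOn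
    exact h

theorem smul {E : ℂ → ℂ} (hE : ExpDominated E) {w : ℝ} (hw : 0 ≤ w) :
    ExpDominated (fun z => (w : ℂ) * E z) where
  differentiable := hE.differentiable.const_mul _
  norm_le z := by
    simpa [abs_of_nonneg hw] using mul_le_mul_of_nonneg_left (hE.norm_le z) hw
  convexOn := by
    have h := hE.convexOn.smul hw
    simpa using h

theorem exp (t : ℝ) : ExpDominated (fun z => Complex.exp (t * z)) where
  differentiable := by fun_prop
  norm_le z := by
    rw [Complex.norm_exp, ← Complex.ofReal_mul, Complex.exp_ofReal_re]
    simp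
  convexOn := by
    have h : ConvexOn ℝ Set.univ fun x : ℝ => Real.exp (t * x) :=
      convexOn_exp.comp_linearMap (LinearMap.mulLeft ℝ t)
    refine h.congr fun x _ => ?_
    simp only
    rw [← Complex.ofReal_mul, Complex.exp_ofReal_re]

theorem apply_ofReal {E : ℂ → ℂ} (hE : ExpDominated E) (x : ℝ) :
    E (x : ℂ) = ((E (x : ℂ)).re : ℂ) := by
  have h := hE.norm_le x
  rw [Complex.ofReal_re] at h
  have hnonneg := Complex.re_eq_norm.1 (le_antisymm (Complex.re_le_norm _) h)
  exact Complex.eq_re_of_ofReal_le (r := 0) (by simpa using hnonneg)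

/-- On a vertical strip, a dominated function is bounded by its values at the two real
end points. -/
theorem norm_le_max {E : ℂ → ℂ} (hE : ExpDominated E) {l u : ℝ} {z : ℂ} (hl : l ≤ z.re)
    (hu : z.re ≤ u) : ‖E z‖ ≤ max (E (l : ℂ)).re (E (u : ℂ)).re :=
  (hE.norm_le z).trans <|
    hE.convexOn.le_max_of_mem_Icc (Set.mem_univ _) (Set.mem_univ _) ⟨hl, hu⟩

end ExpDominated

/-- An exponentially convex function pairs nonnegatively with the polynomials of degree at most
`n` that are nonnegative on the positive half-line. -/
theorem ExpConvexOn.sum_mul_nonneg {f : ℝ → ℝ} {S : Set ℝ} (hf : ExpConvexOn f S) {c h : ℝ}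
    {n : ℕ} (hS : Set.Icc c (c + n * h) ⊆ S) (hh : 0 ≤ h) (p : ℕ → ℝ)
    (hp : ∀ y, 0 < y → 0 ≤ ∑ k ∈ Finset.range (n + 1), p k * y ^ k) :
    0 ≤ ∑ k ∈ Finset.range (n + 1), p k * f (c + k * h) := by
  set P : ℝ[X] := ∑ k ∈ Finset.range (n + 1), C (p k) * X ^ (2 * k) with hP
  have hPn : ∀ x, 0 ≤ P.eval x := by
    refine eval_nonneg_of_forall_ne (a := 0) fun y hy => ?_
    have := hp (y ^ 2) (by positivity)
    simpa [hP, eval_finsetSum, pow_mul] using this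
  obtain ⟨Q, hQ⟩ := exists_map_eq_mul_conj_of_nonneg P hPn
  have hdegP : P.natDegree ≤ 2 * n := by
    refine natDegree_sum_le_of_forall_le _ _ fun k hk => ?_
    refine (natDegree_C_mul_X_pow_le _ _).trans ?_
    have := Finset.mem_range.1 hk
    omega
  have hdegQ : Q.natDegree < n + 1 := by
    have h1 : (P.map Complex.ofRealHom).natDegree = P.natDegree :=
      natDegree_map_eq_of_injective Complex.ofRealHom.injective P
    by_cases hQ0 : Q = 0
    · simp [hQ0]
    · rw [hQ, natDegree_mul hQ0 (by simpa [Polynomial.map_eq_zero] using hQ0),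
        natDegree_map] at h1
      omega
  let m : ℕ → ℂ := fun j => (f (c + j * (h / 2)) : ℂ)
  let L : ℂ[X] →ₗ[ℂ] ℂ := lsum fun j => m j • LinearMap.id
  have hL : ∀ (a : ℂ) (j : ℕ), L (C a * X ^ j) = a * m j := by
    intro a j
    rw [C_mul_X_pow_eq_monomial]
    simp [L, lsum_apply, sum_monomial_index, mul_comm]
  have h1 : L (P.map Complex.ofRealHom)
      = ((∑ k ∈ Finset.range (n + 1), p k * f (c + k * h) : ℝ) : ℂ) := by
    rw [hP, Polynomial.map_sum, map_sum]
    push_cast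
    refine Finset.sum_congr rfl fun k _ => ?_
    rw [Polynomial.map_mul, Polynomial.map_pow, map_X, map_C, hL]
    simp only [m, Complex.ofRealHom_eq_coe]
    congr 4
    push_cast
    ring
  have h2 : L (Q * Q.map (starRingEnd ℂ)) = ∑ r : Fin (n + 1), ∑ s : Fin (n + 1),
      (f ((c / 2 + r * (h / 2)) + (c / 2 + s * (h / 2))) : ℂ) * Q.coeff r
        * (starRingEnd ℂ) (Q.coeff s) := by
    have hexp : Q * Q.map (starRingEnd ℂ) = ∑ r ∈ Finset.range (n + 1),
        ∑ s ∈ Finset.range (n + 1),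
          C (Q.coeff r * (starRingEnd ℂ) (Q.coeff s)) * X ^ (r + s) := by
      conv_lhs => rw [Q.as_sum_range_C_mul_X_pow' hdegQ]
      rw [Polynomial.map_sum, Finset.sum_mul_sum]
      refine Finset.sum_congr rfl fun r _ => Finset.sum_congr rfl fun s _ => ?_
      simp only [Polynomial.map_mul, Polynomial.map_pow, map_X, map_C, C_mul, pow_add]
      ring
    rw [hexp, map_sum, Finset.sum_range]
    refine Finset.sum_congr rfl fun r _ => ?_
    rw [map_sum, Finset.sum_range]
    refine Finset.sum_congr rfl fun s _ => ?_
    rw [hL]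
    have : c + ((r : ℕ) + (s : ℕ) : ℕ) * (h / 2)
        = (c / 2 + r * (h / 2)) + (c / 2 + s * (h / 2)) := by push_cast; ring
    simp only [m, this]
    ring
  have h3 := hf.2 (n + 1) (fun r => c / 2 + (r : ℕ) * (h / 2)) (by
    intro r s
    have hr : ((r : ℕ) : ℝ) ≤ n := by exact_mod_cast Nat.lt_succ_iff.1 r.2
    have hs : ((s : ℕ) : ℝ) ≤ n := by exact_mod_cast Nat.lt_succ_iff.1 s.2
    apply hS
    constructor
    · have : 0 ≤ (r : ℝ) * (h / 2) := by positivity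
      have : 0 ≤ (s : ℝ) * (h / 2) := by positivity
      linarith
    · have := mul_le_mul_of_nonneg_right hr hh
      have := mul_le_mul_of_nonneg_right hs hh
      linarith) (fun r => Q.coeff r)
  rw [← h2, ← hQ, h1] at h3
  exact_mod_cast h3

/-- On an arithmetic progression, an exponentially convex function is approximated by dominated
entire functions. -/
theorem ExpConvexOn.exists_expDominated_near_progression {f : ℝ → ℝ} {S : Set ℝ}
    (hf : ExpConvexOn f S) {c h : ℝ} {n : ℕ} (hS : Set.Icc c (c + n * h) ⊆ S) (hh : 0 < h) {ε : ℝ}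
    (hε : 0 < ε) :
    ∃ E, ExpDominated E ∧ ∀ k : ℕ, k ≤ n →
      |(E ((c + k * h : ℝ) : ℂ)).re - f (c + k * h)| < ε := by
  let ev : (ℂ → ℂ) → (Fin (n + 1) → ℝ) := fun E k => (E ((c + (k : ℕ) * h : ℝ) : ℂ)).re
  let K : Set (Fin (n + 1) → ℝ) := ev '' {E | ExpDominated E}
  let v : Fin (n + 1) → ℝ := fun k => f (c + (k : ℕ) * h)
  have hsmul : ∀ w : ℝ, 0 ≤ w → ∀ x ∈ K, w • x ∈ K := by
    rintro w hw _ ⟨E, hE, rfl⟩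
    exact ⟨_, ExpDominated.smul hE hw, by ext k; simp [ev]⟩
  have hadd : ∀ x ∈ K, ∀ y ∈ K, x + y ∈ K := by
    rintro _ ⟨E, hE, rfl⟩ _ ⟨G, hG, rfl⟩
    exact ⟨_, ExpDominated.add hE hG, by ext k; simp [ev]⟩
  have hconv : Convex ℝ K := fun x hx y hy α β hα hβ _ =>
    hadd _ (hsmul α hα x hx) _ (hsmul β hβ y hy)
  by_cases hv : v ∈ closure K
  · obtain ⟨_, ⟨E, hE, rfl⟩, hd⟩ := Metric.mem_closure_iff.1 hv ε hε
    refine ⟨E, hE, fun k hk => ?_⟩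
    have := (dist_le_pi_dist v (ev E) ⟨k, Nat.lt_succ_of_le hk⟩).trans_lt hd
    rwa [dist_comm, Real.dist_eq] at this
  · exfalso
    obtain ⟨g, u, hgK, hgv⟩ :=
      geometric_hahn_banach_closed_point hconv.closure isClosed_closure hv
    have hu : 0 < u := by
      have h0 : (0 : Fin (n + 1) → ℝ) ∈ K := ⟨0, ExpDominated.zero, by ext k; simp [ev]⟩
      simpa using hgK 0 (subset_closure h0)
    have hneg : ∀ x ∈ K, g x ≤ 0 := by
      intro x hx
      by_contra! hpos
      have := hgK _ (subset_closure (hsmul (u / g x) (by positivity) x hx))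
      rw [map_smul, smul_eq_mul, div_mul_cancel₀ _ hpos.ne'] at this
      exact lt_irrefl _ this
    let p : ℕ → ℝ := fun k => if hk : k < n + 1 then -g (Pi.single ⟨k, hk⟩ 1) else 0
    have hg : ∀ x : ℕ → ℝ, g (fun k : Fin (n + 1) => x k)
        = -∑ k ∈ Finset.range (n + 1), p k * x k := by
      intro x
      have := LinearMap.pi_apply_eq_sum_univ (g : (Fin (n + 1) → ℝ) →ₗ[ℝ] ℝ)
        (fun k : Fin (n + 1) => x k)
      rw [Finset.sum_range, ← Finset.sum_neg_distrib]
      refine this.trans (Finset.sum_congr rfl fun k _ => ?_)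
      have hk : (fun j => if k = j then (1 : ℝ) else 0) = Pi.single k 1 := by
        ext j; simp [Pi.single_apply, eq_comm]
      rw [hk]
      simp [p, mul_comm, Nat.lt_succ_iff.1 k.2]
    have hsum := hf.sum_mul_nonneg hS hh.le p (fun y hy => by
      have hK : ev (fun z => Complex.exp ((Real.log y / h : ℝ) * z)) ∈ K :=
        ⟨_, ExpDominated.exp _, rfl⟩
      have hev : ev (fun z => Complex.exp ((Real.log y / h : ℝ) * z))
          = fun k : Fin (n + 1) =>
            (fun j : ℕ => Real.exp (Real.log y / h * c) * y ^ j) (k : ℕ) := by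
        ext k
        simp only [ev]
        rw [← Complex.ofReal_mul, Complex.exp_ofReal_re, mul_add, Real.exp_add]
        congr 1
        rw [show Real.log y / h * ((k : ℕ) * h) = (k : ℕ) * Real.log y by field_simp,
          Real.exp_nat_mul, Real.exp_log hy]
      have h1 := hneg _ hK
      rw [hev, hg fun j => Real.exp (Real.log y / h * c) * y ^ j, neg_nonpos] at h1
      refine nonneg_of_mul_nonneg_right (a := Real.exp (Real.log y / h * c)) ?_ (Real.exp_pos _)
      rw [Finset.mul_sum]
      refine h1.trans_eq (Finset.sum_congr rfl fun k _ => by ring))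
    have hgv' : g v = -∑ k ∈ Finset.range (n + 1), p k * f (c + k * h) :=
      hg fun k => f (c + k * h)
    linarith

/-- Finitely many rationals lie in `(1 / d) ℤ` for a common positive integer `d`. -/
theorem Finset.exists_common_denominator (s : Finset ℚ) :
    ∃ d : ℕ, 0 < d ∧ ∀ q ∈ s, ∃ k : ℤ, q = k / d := by
  refine ⟨∏ q ∈ s, q.den, Finset.prod_pos fun q _ => q.den_pos, fun q hq => ?_⟩
  obtain ⟨e, he⟩ := Finset.dvd_prod_of_mem (fun q : ℚ => q.den) hq
  have hpos : 0 < ∏ q ∈ s, q.den := Finset.prod_pos fun q _ => q.den_pos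
  have he0 : e ≠ 0 := by rintro rfl; simp at he; omega
  refine ⟨q.num * e, ?_⟩
  rw [he]
  have := q.den_nz
  push_cast
  rw [mul_div_mul_right _ _ (by exact_mod_cast he0), Rat.num_div_den]

/-- On a finite set of rationals, an exponentially convex function is approximated by dominated
entire functions. -/
theorem ExpConvexOn.exists_expDominated_near {f : ℝ → ℝ} {S : Set ℝ} (hf : ExpConvexOn f S)
    (hS : S.OrdConnected) (s : Finset ℚ) (hs : ∀ q ∈ s, (q : ℝ) ∈ S) {ε : ℝ} (hε : 0 < ε) :
    ∃ E, ExpDominated E ∧ ∀ q ∈ s, |(E ((q : ℝ) : ℂ)).re - f q| < ε := by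
  rcases s.eq_empty_or_nonempty with rfl | hne
  · exact ⟨0, ExpDominated.zero, by simp⟩
  obtain ⟨d, hd, hk⟩ := s.exists_common_denominator
  have hd' : (0 : ℝ) < d := by exact_mod_cast hd
  set c := s.min' hne
  have hgrid : ∀ q ∈ s, ∃ k : ℕ, (q : ℝ) = c + k * (1 / d : ℝ) := by
    intro q hq
    obtain ⟨i, hi⟩ := hk q hq
    obtain ⟨j, hj⟩ := hk c (s.min'_mem hne)
    have hle : c ≤ q := s.min'_le q hq
    have hdq : (0 : ℚ) < d := by exact_mod_cast hd
    have hij : j ≤ i := by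
      rw [hi, hj, div_le_div_iff_of_pos_right hdq] at hle
      exact_mod_cast hle
    refine ⟨(i - j).toNat, ?_⟩
    have : (((i - j).toNat : ℤ) : ℝ) = i - j := by
      rw [Int.toNat_of_nonneg (by omega)]; push_cast; ring
    rw [Int.cast_natCast] at this
    rw [this, hi, hj]
    push_cast
    ring
  obtain ⟨n, hn⟩ := hgrid _ (s.max'_mem hne)
  obtain ⟨E, hE, hE'⟩ := hf.exists_expDominated_near_progression (c := c) (h := 1 / d) (n := n)
    (by rw [← hn]; exact hS.out (hs _ (s.min'_mem hne)) (hs _ (s.max'_mem hne)))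
    (by positivity) hε
  refine ⟨E, hE, fun q hq => ?_⟩
  obtain ⟨k, hkq⟩ := hgrid q hq
  have hle : (q : ℝ) ≤ (s.max' hne : ℚ) := by exact_mod_cast s.le_max' q hq
  have hkn : k ≤ n := by
    rw [hn, hkq] at hle
    have : (k : ℝ) * (1 / d) ≤ n * (1 / d) := by linarith
    exact_mod_cast le_of_mul_le_mul_right this (by positivity)
  rw [hkq]
  exact hE' k hkn

/-- Montel's theorem along an ultrafilter: a locally bounded family of holomorphic functions
converges pointwise to a holomorphic function. -/
theorem Ultrafilter.exists_differentiableOn_tendsto {ι : Type*} (𝒰 : Ultrafilter ι)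
    {E : ι → ℂ → ℂ} {U : Set ℂ} (hU : IsOpen U) (hE : ∀ i, DifferentiableOn ℂ (E i) U)
    (hb : ∀ z ∈ U, ∃ r > 0, ∃ M : ℝ, ∀ᶠ i in 𝒰, ∀ w ∈ Metric.ball z r, ‖E i w‖ ≤ M) :
    ∃ F : ℂ → ℂ, DifferentiableOn ℂ F U ∧
      ∀ z ∈ U, Tendsto (fun i => E i z) 𝒰 (𝓝 (F z)) := by
  have hlim : ∀ z ∈ U, ∃ y, Tendsto (fun i => E i z) 𝒰 (𝓝 y) := by
    intro z hz
    obtain ⟨r, hr, M, hM⟩ := hb z hz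
    obtain ⟨y, -, hy⟩ := (isCompact_closedBall (0 : ℂ) M).ultrafilter_le_nhds
      (𝒰.map fun i => E i z) (by
        rw [le_principal_iff]
        change ∀ᶠ i in 𝒰, E i z ∈ Metric.closedBall 0 M
        filter_upwards [hM] with i hi
        simpa using hi z (Metric.mem_ball_self hr))
    exact ⟨y, hy⟩
  choose! F hF using hlim
  refine ⟨F, ?_, hF⟩
  have hloc : TendstoLocallyUniformlyOn E F 𝒰 U := by
    rw [Metric.tendstoLocallyUniformlyOn_iff]
    intro ε hε x hx
    obtain ⟨r₁, hr₁, M, hM⟩ := hb x hx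
    obtain ⟨r₂, hr₂, hsub⟩ := Metric.isOpen_iff.1 hU x hx
    set r := min r₁ r₂
    have hr : 0 < r := lt_min hr₁ hr₂
    have hM1 : 0 < 2 * |M| + 1 := by positivity
    set δ := min r (ε / 4 * r / (2 * |M| + 1))
    have hδ : 0 < δ := lt_min hr (by positivity)
    have hball : Metric.ball x r ⊆ U := (Metric.ball_subset_ball (min_le_right _ _)).trans hsub
    have heq : ∀ᶠ i in 𝒰, ∀ y ∈ Metric.ball x δ, dist (E i y) (E i x) ≤ ε / 4 := by
      filter_upwards [hM] with i hi y hy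
      have hi' : ∀ w ∈ Metric.ball x r, ‖E i w‖ ≤ |M| := fun w hw =>
        (hi w (Metric.ball_subset_ball (min_le_left _ _) hw)).trans (le_abs_self M)
      have h := Complex.dist_le_div_mul_dist_of_mapsTo_ball (f := E i) (c := x) (z := y)
        (R₁ := r) (R₂ := 2 * |M| + 1) ((hE i).mono hball) (by
          intro w hw
          rw [Metric.mem_closedBall, dist_eq_norm]
          have h1 := norm_sub_le (E i w) (E i x)
          have h2 := hi' w hw
          have h3 := hi' x (Metric.mem_ball_self hr)
          linarith) (Metric.ball_subset_ball (min_le_left _ _) hy)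
      refine h.trans ?_
      have hy' : dist y x ≤ ε / 4 * r / (2 * |M| + 1) :=
        (Metric.mem_ball.1 hy).le.trans (min_le_right _ _)
      calc (2 * |M| + 1) / r * dist y x
          ≤ (2 * |M| + 1) / r * (ε / 4 * r / (2 * |M| + 1)) := by gcongr
        _ = ε / 4 := by field_simp
    refine ⟨Metric.ball x δ, mem_nhdsWithin_of_mem_nhds (Metric.ball_mem_nhds x hδ), ?_⟩
    have hx' : ∀ᶠ i in 𝒰, dist (E i x) (F x) < ε / 4 :=
      Metric.tendsto_nhds.1 (hF x hx) _ (by positivity)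
    filter_upwards [heq, hx'] with i hi hix y hy
    have hyU : y ∈ U := hball (Metric.ball_subset_ball (min_le_left _ _) hy)
    have hFy : dist (F y) (F x) ≤ ε / 4 :=
      le_of_tendsto ((hF y hyU).dist (hF x hx)) (heq.mono fun j hj => hj y hy)
    have h1 := dist_triangle4 (F y) (F x) (E i x) (E i y)
    have h2 := hi y hy
    rw [dist_comm] at h2 hix
    linarith
  exact hloc.differentiableOn (Eventually.of_forall hE) hU

/-- A function exponentially convex on an open interval extends holomorphically to the vertical
strip over it. -/
theorem ExpConvexOn.exists_differentiableOn {f : ℝ → ℝ} {S : Set ℝ} (hf : ExpConvexOn f S)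
    (hS : S.OrdConnected) (hSo : IsOpen S) :
    ∃ F : ℂ → ℂ, DifferentiableOn ℂ F (Complex.re ⁻¹' S) ∧ ∀ x ∈ S, F (x : ℂ) = (f x : ℂ) := by
  classical
  have happrox : ∀ s : Finset ℚ, ∃ E, ExpDominated E ∧ ∀ q ∈ s, (q : ℝ) ∈ S →
      |(E ((q : ℝ) : ℂ)).re - f q| < 1 / (s.card + 1) := by
    intro s
    obtain ⟨E, hE, hEs⟩ := hf.exists_expDominated_near hS (s.filter fun q : ℚ => (q : ℝ) ∈ S)
      (fun q hq => (Finset.mem_filter.1 hq).2) (ε := 1 / (s.card + 1)) (by positivity)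
    exact ⟨E, hE, fun q hq hqS => hEs q (Finset.mem_filter.2 ⟨hq, hqS⟩)⟩
  choose E hE hEf using happrox
  let 𝒰 : Ultrafilter (Finset ℚ) := Ultrafilter.of atTop
  have h𝒰 : (𝒰 : Filter (Finset ℚ)) ≤ atTop := Ultrafilter.of_le atTop
  have hcard : Tendsto (fun s : Finset ℚ => (1 : ℝ) / (s.card + 1)) atTop (𝓝 0) :=
    tendsto_one_div_add_atTop_nhds_zero_nat.comp tendsto_card_atTop_atTop
  have hq : ∀ q : ℚ, (q : ℝ) ∈ S →
      Tendsto (fun s => (E s ((q : ℝ) : ℂ)).re) 𝒰 (𝓝 (f q)) := by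
    intro q hqS
    refine Tendsto.mono_left ?_ h𝒰
    rw [tendsto_iff_dist_tendsto_zero]
    refine squeeze_zero' (Eventually.of_forall fun _ => dist_nonneg) ?_ hcard
    filter_upwards [eventually_ge_atTop {q}] with s hs
    exact (hEf s q (hs (Finset.mem_singleton_self q)) hqS).le
  have hexists : ∀ x ∈ S, ∃ l u : ℚ, (l : ℝ) < x ∧ x < u ∧ (l : ℝ) ∈ S ∧ (u : ℝ) ∈ S := by
    intro x hx
    obtain ⟨ε, hε, hball⟩ := Metric.isOpen_iff.1 hSo x hx
    obtain ⟨l, hl, hl'⟩ := exists_rat_btwn (sub_lt_self x hε)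
    obtain ⟨u, hu, hu'⟩ := exists_rat_btwn (lt_add_of_pos_right x hε)
    refine ⟨l, u, hl', hu, hball ?_, hball ?_⟩ <;>
      rw [Metric.mem_ball, Real.dist_eq, abs_lt] <;> constructor <;> linarith
  obtain ⟨F, hFd, hF⟩ := 𝒰.exists_differentiableOn_tendsto (E := E)
    (hSo.preimage Complex.continuous_re) (fun s => (hE s).differentiable.differentiableOn) (by
      intro z hz
      obtain ⟨l, u, hl, hu, hlS, huS⟩ := hexists z.re hz
      have hopen : IsOpen (Complex.re ⁻¹' Set.Ioo (l : ℝ) u) :=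
        isOpen_Ioo.preimage Complex.continuous_re
      obtain ⟨r, hr, hball⟩ := Metric.isOpen_iff.1 hopen z ⟨hl, hu⟩
      refine ⟨r, hr, max (f l + 1) (f u + 1), ?_⟩
      filter_upwards [(hq l hlS).eventually_le_const (lt_add_one _),
        (hq u huS).eventually_le_const (lt_add_one _)] with s hsl hsu w hw
      have hw' := hball hw
      exact ((hE s).norm_le_max hw'.1.le hw'.2.le).trans (max_le_max hsl hsu))
  refine ⟨F, hFd, ?_⟩
  have hrat : ∀ q : ℚ, (q : ℝ) ∈ S → F ((q : ℝ) : ℂ) = (f q : ℂ) := by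
    intro q hqS
    refine tendsto_nhds_unique (hF ((q : ℝ) : ℂ) (by simpa using hqS)) ?_
    refine Tendsto.congr (fun s => ((hE s).apply_ofReal (q : ℝ)).symm) ?_
    exact (Complex.continuous_ofReal.tendsto _).comp (hq q hqS)
  have hcont : ContinuousOn (fun x : ℝ => F (x : ℂ)) S :=
    hFd.continuousOn.comp Complex.continuous_ofReal.continuousOn fun x hx => by simpa using hx
  have hcont' : ContinuousOn (fun x : ℝ => (f x : ℂ)) S :=
    Complex.continuous_ofReal.comp_continuousOn hf.1
  have heq : Set.EqOn (fun x : ℝ => F (x : ℂ)) (fun x : ℝ => (f x : ℂ))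
      (S ∩ Set.range ((↑) : ℚ → ℝ)) := by
    rintro _ ⟨hx, q, rfl⟩
    exact hrat q hx
  exact heq.of_subset_closure hcont hcont' Set.inter_subset_left
    (Rat.denseRange_cast.open_subset_closure_inter hSo)

theorem stmt_14 (a b : EReal) (hab : a < b) (f : ℝ → ℝ)
    (hf : ExpConvexOn f {x : ℝ | a < (x : EReal) ∧ (x : EReal) < b}) :
    ∃ F : ℂ → ℂ,
      DifferentiableOn ℂ F {z : ℂ | a < (z.re : EReal) ∧ (z.re : EReal) < b} ∧
      ∀ x : ℝ, a < (x : EReal) → (x : EReal) < b → F (x : ℂ) = (f x : ℂ) := by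
  obtain ⟨F, hFd, hF⟩ := hf.exists_differentiableOn
    ⟨fun x hx y hy z hz => ⟨hx.1.trans_le (EReal.coe_le_coe_iff.2 hz.1),
      (EReal.coe_le_coe_iff.2 hz.2).trans_lt hy.2⟩⟩
    (isOpen_Ioo.preimage continuous_coe_real_ereal)
  exact ⟨F, hFd, fun x hx hx' => hF x ⟨hx, hx'⟩⟩
end

section
/- If t is a complex number with Im t > 0, then every complex root of the polynomial P − t·Q lies in the open upper half-plane, i.e., every z ∈ ℂ with P(z) − t·Q(z) = 0 satisfies Im z > 0. -/
open Polynomial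

theorem stmt_16 (n : ℕ) (hn : 1 ≤ n) (μ α : Fin n → ℝ)
    (hμ : ∀ i j : Fin n, i < j → μ j < μ i) (hα : ∀ k, 0 < α k)
    (Q P : Polynomial ℂ)
    (hQ : Q = ∏ k, (X - C (μ k : ℂ)))
    (hP : P = X * Q - ∑ k, C (α k : ℂ) * ∏ j ∈ Finset.univ.erase k, (X - C (μ j : ℂ)))
    (t : ℂ) (ht : 0 < t.im) :
    ∀ z : ℂ, (P - C t * Q).eval z = 0 → 0 < z.im := by
  intro z hz
  by_contra! hzim
  have hroot : (z - t) * ∏ k, (z - (μ k : ℂ)) =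
      ∑ k, (α k : ℂ) * ∏ j ∈ Finset.univ.erase k, (z - (μ j : ℂ)) := by
    simp only [hP, hQ, eval_sub, eval_mul, eval_X, eval_C, eval_prod, eval_finsetSum] at hz
    linear_combination hz
  by_cases hpole : ∃ k, z = μ k
  · obtain ⟨k, rfl⟩ := hpole
    rw [Finset.prod_eq_zero (Finset.mem_univ k) (sub_self _), mul_zero,
      Finset.sum_eq_single k] at hroot
    · refine mul_ne_zero (mod_cast (hα k).ne') (Finset.prod_ne_zero_iff.2 fun j hj => ?_)
        hroot.symm
      have hjk : j ≠ k := Finset.ne_of_mem_erase hj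
      have hne : μ k ≠ μ j := by
        rcases hjk.lt_or_gt with h | h
        · exact (hμ _ _ h).ne
        · exact (hμ _ _ h).ne'
      exact sub_ne_zero.2 (mod_cast hne)
    · intro j _ hjk
      rw [Finset.prod_eq_zero (Finset.mem_erase.2 ⟨hjk.symm, Finset.mem_univ k⟩) (sub_self _),
        mul_zero]
    · simp
  · push Not at hpole
    have hfac : ∀ k, z - (μ k : ℂ) ≠ 0 := fun k => sub_ne_zero.2 (hpole k)
    have hprod : ∏ k, (z - (μ k : ℂ)) ≠ 0 := Finset.prod_ne_zero_iff.2 fun k _ => hfac k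
    have hsum : z - t = ∑ k, (α k : ℂ) * (z - (μ k : ℂ))⁻¹ := by
      apply mul_right_cancel₀ hprod
      rw [hroot, Finset.sum_mul]
      refine Finset.sum_congr rfl fun k _ => ?_
      rw [← Finset.mul_prod_erase _ _ (Finset.mem_univ k), mul_assoc,
        inv_mul_cancel_left₀ (hfac k)]
    have him := congrArg Complex.im hsum
    have hnonneg : 0 ≤ ∑ k, ((α k : ℂ) * (z - (μ k : ℂ))⁻¹).im := by
      refine Finset.sum_nonneg fun k _ => ?_
      rw [Complex.im_ofReal_mul, Complex.inv_im, Complex.sub_im, Complex.ofReal_im, sub_zero]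
      exact mul_nonneg (hα k).le (div_nonneg (neg_nonneg.2 hzim) (Complex.normSq_nonneg _))
    rw [Complex.im_sum, Complex.sub_im] at him
    linarith
end

section
/- For every real t, the polynomial P − t·Q (which is monic of degree n+1) has n+1 pairwise distinct real roots ν_0(t) > ν_1(t) > ⋯ > ν_n(t), and these roots are interspersed with the numbers μ_k: ν_0(t) > μ_1 > ν_1(t) > μ_2 > ν_2(t) > ⋯ > ν_{n−1}(t) > μ_n > ν_n(t). -/
open Polynomial

/-- For a strictly decreasing family, the sign of `∏ j ≠ k, (μ k - μ j)` is `(-1) ^ k`. -/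
lemma neg_one_pow_mul_prod_erase_sub_pos {n : ℕ} {μ : Fin n → ℝ} (hμ : StrictAnti μ)
    (k : Fin n) :
    0 < (-1 : ℝ) ^ (k : ℕ) * ∏ j ∈ Finset.univ.erase k, (μ k - μ j) := by
  have hsign : (-1 : ℝ) ^ (k : ℕ) =
      ∏ j ∈ Finset.univ.erase k, if j < k then (-1 : ℝ) else 1 := by
    have hfilter : (Finset.univ.erase k).filter (· < k) = Finset.Iio k := by
      ext j
      simpa using fun h : j < k => h.ne
    rw [Finset.prod_ite, Finset.prod_const, Finset.prod_const_one, mul_one, hfilter, Fin.card_Iio]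
  rw [hsign, ← Finset.prod_mul_distrib]
  refine Finset.prod_pos fun j hj => ?_
  rcases lt_or_gt_of_ne (Finset.ne_of_mem_erase hj) with h | h
  · have := hμ h
    simp only [h, if_true]
    linarith
  · have := hμ h
    simp only [h.not_gt, if_false]
    linarith

lemma Polynomial.Monic.exists_gt_eval_pos {F : ℝ[X]} (hF : F.Monic) (hd : 0 < F.natDegree)
    (M : ℝ) : ∃ x, M < x ∧ 0 < F.eval x := by
  have h := F.tendsto_atTop_of_leadingCoeff_nonneg (natDegree_pos_iff_degree_pos.1 hd)
    (by rw [hF.leadingCoeff]; exact zero_le_one)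
  exact ((Filter.eventually_gt_atTop M).and (h.eventually_gt_atTop 0)).exists

lemma Polynomial.Monic.exists_lt_neg_one_pow_mul_eval_pos {F : ℝ[X]} (hF : F.Monic)
    (hd : 0 < F.natDegree) (M : ℝ) : ∃ x, x < M ∧ 0 < (-1) ^ F.natDegree * F.eval x := by
  have hdeg : (F.comp (-X)).natDegree = F.natDegree := by simp [natDegree_comp]
  have hmonic := hF.neg_one_pow_natDegree_mul_comp_neg_X
  have hdeg' : ((-1) ^ F.natDegree * F.comp (-X)).natDegree = F.natDegree := by
    rcases neg_one_pow_eq_or ℝ[X] F.natDegree with h | h <;> simp [h, hdeg]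
  obtain ⟨x, hx, hpos⟩ := hmonic.exists_gt_eval_pos (hdeg'.symm ▸ hd) (-M)
  exact ⟨-x, by linarith, by simpa [eval_comp] using hpos⟩

/-- A real monic polynomial of degree `n + 1` whose values at `n` decreasing points `μ k` have
sign `(-1) ^ (k + 1)` has `n + 1` real roots interlacing these points. -/
lemma Polynomial.Monic.exists_interlacing_roots {n : ℕ} {μ : Fin n → ℝ} (hμ : StrictAnti μ)
    {F : ℝ[X]} (hF : F.Monic) (hdeg : F.natDegree = n + 1)
    (hsign : ∀ k : Fin n, (-1) ^ (k : ℕ) * F.eval (μ k) < 0) :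
    ∃ ν : Fin (n + 1) → ℝ, StrictAnti ν ∧ (∀ k, F.eval (ν k) = 0) ∧
      ∀ k : Fin n, μ k < ν k.castSucc ∧ ν k.succ < μ k := by
  obtain ⟨B, hB⟩ := (Set.finite_range μ).bddAbove
  obtain ⟨A, hA⟩ := (Set.finite_range μ).bddBelow
  obtain ⟨a, ha, hFa⟩ := hF.exists_gt_eval_pos (by omega) B
  obtain ⟨b, hb, hFb⟩ := hF.exists_lt_neg_one_pow_mul_eval_pos (by omega) (min A a)
  have hμa : ∀ k, μ k < a := fun k => (hB ⟨k, rfl⟩).trans_lt ha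
  have hbμ : ∀ k, b < μ k := fun k => (hb.trans_le (min_le_left _ _)).trans_le (hA ⟨k, rfl⟩)
  have hba : b < a := hb.trans_le (min_le_right _ _)
  let L : Fin (n + 1) → ℝ := Fin.snoc μ b
  let U : Fin (n + 1) → ℝ := Fin.cons a μ
  have hLU : ∀ i, L i < U i := by
    intro i
    rcases Fin.eq_castSucc_or_eq_last i with ⟨j, hj⟩ | hj <;>
    rcases Fin.eq_zero_or_eq_succ i with hk | ⟨k, hk⟩
    · rw [show L i = μ j by simp [L, hj], show U i = a by simp [U, hk]]
      exact hμa j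
    · rw [show L i = μ j by simp [L, hj], show U i = μ k by simp [U, hk]]
      apply hμ
      have := congrArg Fin.val (hj.symm.trans hk)
      simp only [Fin.val_castSucc, Fin.val_succ] at this
      exact Fin.lt_def.2 (by omega)
    · rw [show L i = b by simp [L, hj], show U i = a by simp [U, hk]]
      exact hba
    · rw [show L i = b by simp [L, hj], show U i = μ k by simp [U, hk]]
      exact hbμ k
  have hL : ∀ i : Fin (n + 1), (-1) ^ (i : ℕ) * F.eval (L i) < 0 := by
    intro i
    induction i using Fin.lastCases with
    | last =>
      rw [hdeg, pow_succ] at hFb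
      simp only [L, Fin.snoc_last, Fin.val_last]
      linarith
    | cast k => simpa [L] using hsign k
  have hU : ∀ i : Fin (n + 1), 0 < (-1) ^ (i : ℕ) * F.eval (U i) := by
    intro i
    induction i using Fin.cases with
    | zero => simpa [U] using hFa
    | succ k =>
      have := hsign k
      simp only [U, Fin.cons_succ, Fin.val_succ, pow_succ]
      linarith
  have hroot : ∀ i : Fin (n + 1), ∃ x, (L i < x ∧ x < U i) ∧ F.eval x = 0 := by
    intro i
    have hcont : ContinuousOn (fun x => (-1) ^ (i : ℕ) * F.eval x) (Set.Icc (L i) (U i)) := by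
      fun_prop
    obtain ⟨x, hx, hx0⟩ := intermediate_value_Ioo (hLU i).le hcont ⟨hL i, hU i⟩
    exact ⟨x, hx, by simpa using hx0⟩
  choose ν hν hν0 using hroot
  have hinter : ∀ k : Fin n, μ k < ν k.castSucc ∧ ν k.succ < μ k := fun k =>
    ⟨by simpa [L] using (hν k.castSucc).1, by simpa [U] using (hν k.succ).2⟩
  exact ⟨ν, Fin.strictAnti_iff_succ_lt.2 fun k => (hinter k).2.trans (hinter k).1, hν0, hinter⟩

theorem stmt_17 (n : ℕ) (hn : 1 ≤ n) (μ α : Fin n → ℝ)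
    (hμ : ∀ i j : Fin n, i < j → μ j < μ i) (hα : ∀ k, 0 < α k)
    (Q P : Polynomial ℝ)
    (hQ : Q = ∏ k, (X - C (μ k)))
    (hP : P = X * Q - ∑ k, C (α k) * ∏ j ∈ Finset.univ.erase k, (X - C (μ j))) :
    ∀ t : ℝ, ∃ ν : Fin (n + 1) → ℝ,
      StrictAnti ν ∧
      (∀ k, (P - C t * Q).eval (ν k) = 0) ∧
      (∀ k : Fin n, μ k < ν k.castSucc ∧ ν k.succ < μ k) := by
  intro t
  have hanti : StrictAnti μ := fun i j hij => hμ i j hij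
  have hQm : Q.Monic := hQ ▸ monic_prod_X_sub_C μ Finset.univ
  have hQd : Q.natDegree = n := by
    rw [hQ, natDegree_prod_of_monic _ _ fun k _ => monic_X_sub_C (μ k)]
    simp
  set S : ℝ[X] := ∑ k, C (α k) * ∏ j ∈ Finset.univ.erase k, (X - C (μ j)) with hS
  have hPQ : P - C t * Q = (X - C t) * Q - S := by rw [hP]; ring
  have hSd : S.natDegree ≤ n := by
    refine natDegree_sum_le_of_forall_le _ _ fun k _ => (natDegree_C_mul_le _ _).trans ?_
    rw [natDegree_prod_of_monic _ _ fun j _ => monic_X_sub_C (μ j)]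
    simp
  have hmonic : ((X - C t) * Q).Monic := (monic_X_sub_C t).mul hQm
  have hnat : ((X - C t) * Q).natDegree = n + 1 := by
    rw [(monic_X_sub_C t).natDegree_mul hQm, natDegree_X_sub_C, hQd, add_comm]
  have hlt : S.natDegree < ((X - C t) * Q).natDegree := by omega
  rw [hPQ]
  refine (hmonic.sub_of_left (degree_lt_degree hlt)).exists_interlacing_roots hanti
    ((natDegree_sub_eq_left_of_natDegree_lt hlt).trans hnat) fun k => ?_
  have hQk : Q.eval (μ k) = 0 := by
    rw [hQ, eval_prod]
    exact Finset.prod_eq_zero (Finset.mem_univ k) (by simp)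
  have hSk : S.eval (μ k) = α k * ∏ j ∈ Finset.univ.erase k, (μ k - μ j) := by
    rw [hS, eval_finsetSum, Finset.sum_eq_single k]
    · simp [eval_prod]
    · intro i _ hik
      rw [eval_mul, eval_prod, Finset.prod_eq_zero (i := k) (by simp [hik.symm]) (by simp),
        mul_zero]
    · simp
  have hpos := mul_pos (hα k) (neg_one_pow_mul_prod_erase_sub_pos hanti k)
  rw [eval_sub, eval_mul, hQk, hSk]
  linarith
end

section
/- The polynomial P′·Q − Q′·P has degree exactly 2n, and it is strictly positive on the real axis: P′(x)·Q(x) − Q′(x)·P(x) > 0 for every real x. -/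
open Polynomial

/-- The Wronskian of `(X - a) * f` and `f` is `f ^ 2`. -/
theorem derivative_X_sub_C_mul_wronskian {R : Type*} [CommRing R] (a : R) (f : R[X]) :
    derivative ((X - C a) * f) * f - derivative f * ((X - C a) * f) = f ^ 2 := by
  simp only [derivative_mul, derivative_X_sub_C]
  ring

/-- The Wronskian of `X * q - ∑ k, α k * f k` and `q` as a combination of squares, when each `f k`
is the quotient of `q` by a monic linear factor. -/
theorem derivative_mul_sub_eq_sq_add_sum_sq {R ι : Type*} [CommRing R] [Fintype ι]
    (μ α : ι → R) (q : R[X]) (f : ι → R[X]) (hf : ∀ k, (X - C (μ k)) * f k = q) :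
    derivative (X * q - ∑ k, C (α k) * f k) * q - derivative q * (X * q - ∑ k, C (α k) * f k) =
      q ^ 2 + ∑ k, C (α k) * f k ^ 2 := by
  have hsq : ∑ k, C (α k) * f k ^ 2 =
      derivative q * (∑ k, C (α k) * f k) - (∑ k, C (α k) * derivative (f k)) * q := by
    rw [Finset.mul_sum, Finset.sum_mul, ← Finset.sum_sub_distrib]
    refine Finset.sum_congr rfl fun k _ => ?_
    rw [← derivative_X_sub_C_mul_wronskian (μ k) (f k), hf k]
    ring
  rw [hsq]
  simp only [derivative_sub, derivative_mul, derivative_X, derivative_sum, derivative_C]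
  simp only [zero_mul, zero_add]
  ring

theorem stmt_18 (n : ℕ) (hn : 1 ≤ n) (μ α : Fin n → ℝ)
    (hμ : ∀ i j : Fin n, i < j → μ j < μ i) (hα : ∀ k, 0 < α k)
    (Q P : Polynomial ℝ)
    (hQ : Q = ∏ k, (X - C (μ k)))
    (hP : P = X * Q - ∑ k, C (α k) * ∏ j ∈ Finset.univ.erase k, (X - C (μ j))) :
    (P.derivative * Q - Q.derivative * P).natDegree = 2 * n ∧
    (P.derivative * Q - Q.derivative * P) ≠ 0 ∧
    ∀ x : ℝ, 0 < (P.derivative * Q - Q.derivative * P).eval x := by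
  have hinj : Function.Injective μ := StrictAnti.injective fun i j h => hμ i j h
  set f : Fin n → ℝ[X] := fun k => ∏ j ∈ Finset.univ.erase k, (X - C (μ j)) with hf
  have hfac : ∀ k, (X - C (μ k)) * f k = Q := fun k => by
    rw [hQ]
    exact Finset.mul_prod_erase Finset.univ (fun j => X - C (μ j)) (Finset.mem_univ k)
  have hW : P.derivative * Q - Q.derivative * P = Q ^ 2 + ∑ k, C (α k) * f k ^ 2 := by
    rw [hP]
    exact derivative_mul_sub_eq_sq_add_sum_sq μ α Q f hfac
  have hpos : ∀ x : ℝ, 0 < (P.derivative * Q - Q.derivative * P).eval x := by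
    intro x
    rw [hW]
    simp only [eval_add, eval_pow, eval_finsetSum, eval_mul, eval_C]
    have hterm : ∀ k ∈ Finset.univ, 0 ≤ α k * (f k).eval x ^ 2 := fun k _ =>
      mul_nonneg (hα k).le (sq_nonneg _)
    by_cases hx : Q.eval x = 0
    · obtain ⟨k, -, hk⟩ : ∃ k ∈ Finset.univ, (X - C (μ k)).eval x = 0 := by
        rwa [hQ, eval_prod, Finset.prod_eq_zero_iff] at hx
      have hxk : x = μ k := by simpa [sub_eq_zero] using hk
      have hfk : (f k).eval x ≠ 0 := by
        rw [hf, eval_prod, Finset.prod_ne_zero_iff]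
        intro j hj
        simpa [hxk, sub_eq_zero] using fun h => Finset.ne_of_mem_erase hj (hinj h).symm
      have := hα k
      exact add_pos_of_nonneg_of_pos (sq_nonneg _)
        (Finset.sum_pos' hterm ⟨k, Finset.mem_univ k, by positivity⟩)
    · exact add_pos_of_pos_of_nonneg (by positivity) (Finset.sum_nonneg hterm)
  refine ⟨?_, fun h => by simpa [h] using hpos 0, hpos⟩
  have hQdeg : (Q ^ 2).natDegree = 2 * n := by
    rw [natDegree_pow, hQ, natDegree_finsetProd_X_sub_C_eq_card]
    simp
  have hfdeg : ∀ k, (f k).natDegree = n - 1 := fun k => by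
    rw [hf, natDegree_finsetProd_X_sub_C_eq_card]
    simp
  rw [hW, natDegree_add_eq_left_of_natDegree_lt, hQdeg]
  rw [hQdeg]
  refine lt_of_le_of_lt (natDegree_sum_le_of_forall_le (n := 2 * (n - 1)) _ _ fun k _ => ?_)
    (by omega)
  exact (natDegree_C_mul_le _ _).trans (by rw [natDegree_pow, hfdeg])
end
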